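/- arXiv:1001.4043 — 5 statements merged into one kernel-verified Lean document; each statement's English description precedes it below -/
import Mathlib

section
/- Let ω and σ be locally finite positive Borel measures on ℝ having no point masses, and suppose the A₂ constant 𝒜₂ of the pair (ω,σ) is finite. Then there is an absolute constant C such that for all real numbers 0 < a ≤ b, ∫_{(−a,0)} ∫_{(0,b)} (y−x)^{-1} dσ(y) dω(x) ≤ C·𝒜₂·( ω((−a,0)) · σ((0,b)) )^{1/2}. (Here the integrand (y−x)^{-1} is positive on the indicated region, so the double integral is well defined in [0,∞].) -/
open MeasureTheory Set ENNReal

/-- The Poisson integral `P(I,ν)` of the interval `I = [a,b]`. -/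
noncomputable def poisson (ν : Measure ℝ) (a b : ℝ) : ℝ≥0∞ :=
  ∫⁻ x, ENNReal.ofReal ((b - a) / ((b - a) + Metric.infDist x (Set.Icc a b)) ^ 2) ∂ν

/-- The `A₂` condition with constant `A`: `P(I,ω)·P(I,σ) ≤ A²` for all bounded intervals `I`. -/
def A2Bound (ω σ : Measure ℝ) (A : ℝ) : Prop :=
  ∀ a b : ℝ, a ≤ b → poisson ω a b * poisson σ a b ≤ ENNReal.ofReal A ^ 2

theorem measurable_measure_Iic (μ : Measure ℝ) : Measurable fun x => μ (Iic x) :=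
  Monotone.measurable fun _ _ h => measure_mono (Iic_subset_Iic.2 h)

/-- Tonelli's theorem on the half-plane `x ≤ y`. -/
theorem lintegral_Iic_swap (μ ν : Measure ℝ) [SFinite μ] [SFinite ν] {f g : ℝ → ℝ≥0∞}
    (hf : Measurable f) (hg : Measurable g) :
    ∫⁻ y, (∫⁻ x in Iic y, f x ∂μ) * g y ∂ν = ∫⁻ x, f x * ∫⁻ y in Ici x, g y ∂ν ∂μ := by
  have hm : Measurable fun p : ℝ × ℝ =>
      {q : ℝ × ℝ | q.2 ≤ q.1}.indicator (fun q => f q.2 * g q.1) p :=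
    ((hf.comp measurable_snd).mul (hg.comp measurable_fst)).indicator
      (measurableSet_le measurable_snd measurable_fst)
  calc ∫⁻ y, (∫⁻ x in Iic y, f x ∂μ) * g y ∂ν
      = ∫⁻ y, ∫⁻ x, {q : ℝ × ℝ | q.2 ≤ q.1}.indicator (fun q => f q.2 * g q.1) (y, x) ∂μ ∂ν := by
        refine lintegral_congr fun y => ?_
        rw [← lintegral_mul_const _ hf, ← lintegral_indicator measurableSet_Iic]
        rfl
    _ = ∫⁻ x, ∫⁻ y, {q : ℝ × ℝ | q.2 ≤ q.1}.indicator (fun q => f q.2 * g q.1) (y, x) ∂ν ∂μ :=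
        lintegral_lintegral_swap hm.aemeasurable
    _ = ∫⁻ x, f x * ∫⁻ y in Ici x, g y ∂ν ∂μ := by
        refine lintegral_congr fun x => ?_
        rw [← lintegral_const_mul _ hg, ← lintegral_indicator measurableSet_Ici]
        rfl

theorem measure_univ_sq_le_lintegral_Iic (μ : Measure ℝ) [SFinite μ] :
    μ univ ^ 2 ≤ 2 * ∫⁻ x, μ (Iic x) ∂μ := by
  have hswap : ∫⁻ x, μ (Iic x) ∂μ = ∫⁻ x, μ (Ici x) ∂μ := by
    simpa using lintegral_Iic_swap μ μ (f := fun _ => 1) (g := fun _ => 1)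
      measurable_const measurable_const
  calc μ univ ^ 2 = ∫⁻ _, μ univ ∂μ := by rw [lintegral_const, sq]
    _ ≤ ∫⁻ x, μ (Iic x) + μ (Ici x) ∂μ := by
        refine lintegral_mono fun x => ?_
        rw [← Iic_union_Ici (a := x)]
        exact measure_union_le _ _
    _ = 2 * ∫⁻ x, μ (Iic x) ∂μ := by
        rw [lintegral_add_left (measurable_measure_Iic μ), ← hswap, two_mul]

theorem measure_Iic_sq_le (μ : Measure ℝ) [SFinite μ] (y : ℝ) :
    μ (Iic y) ^ 2 ≤ 2 * ∫⁻ x in Iic y, μ (Iic x) ∂μ := by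
  have h := measure_univ_sq_le_lintegral_Iic (μ.restrict (Iic y))
  rw [Measure.restrict_apply_univ] at h
  refine h.trans ?_
  gcongr with x
  exact Measure.restrict_le_self

/-- A Muckenhoupt condition implies the Hardy inequality tested on constants. -/
theorem lintegral_measure_Iic_mul_le (μ ν : Measure ℝ) [SFinite μ] [SFinite ν] {k : ℝ → ℝ≥0∞}
    (hk : Measurable k) {B : ℝ≥0∞}
    (h : ∀ᵐ x ∂μ, μ (Iic x) * ∫⁻ y in Ici x, k y ^ 2 ∂ν ≤ B) :
    ∫⁻ y, μ (Iic y) * k y ∂ν ≤ (2 * B) ^ ((1:ℝ)/2) * (μ univ * ν univ) ^ ((1:ℝ)/2) := by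
  have hsq : ∫⁻ y, (μ (Iic y) * k y) ^ 2 ∂ν ≤ 2 * B * μ univ := by
    calc ∫⁻ y, (μ (Iic y) * k y) ^ 2 ∂ν
        ≤ ∫⁻ y, 2 * ((∫⁻ x in Iic y, μ (Iic x) ∂μ) * k y ^ 2) ∂ν := by
          refine lintegral_mono fun y => ?_
          rw [mul_pow, ← mul_assoc]
          gcongr
          exact measure_Iic_sq_le μ y
      _ = 2 * ∫⁻ x, μ (Iic x) * ∫⁻ y in Ici x, k y ^ 2 ∂ν ∂μ := by
          rw [lintegral_const_mul' _ _ (by simp),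
            lintegral_Iic_swap μ ν (measurable_measure_Iic μ) (hk.pow_const 2)]
      _ ≤ 2 * ∫⁻ _, B ∂μ := by
          gcongr 2 * ?_
          exact lintegral_mono_ae h
      _ = 2 * B * μ univ := by rw [lintegral_const, mul_assoc]
  have hCS := ENNReal.lintegral_mul_le_Lp_mul_Lq ν Real.HolderConjugate.two_two
    ((measurable_measure_Iic μ).mul hk).aemeasurable (aemeasurable_const (b := (1 : ℝ≥0∞)))
  simp only [Pi.mul_apply, mul_one, ENNReal.rpow_two, one_pow, lintegral_const, one_mul] at hCS
  refine hCS.trans ?_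
  rw [← ENNReal.mul_rpow_of_nonneg _ _ (by norm_num),
    ← ENNReal.mul_rpow_of_nonneg _ _ (by norm_num), ← mul_assoc]
  gcongr

theorem lintegral_inv_add_le (μ ν : Measure ℝ) [SFinite μ] [SFinite ν]
    (hμ : ∀ᵐ x ∂μ, 0 < x) (hν : ∀ᵐ y ∂ν, 0 < y) {B : ℝ≥0∞}
    (h₁ : ∀ x, 0 < x → μ (Iic x) * ∫⁻ y in Ici x, ENNReal.ofReal y⁻¹ ^ 2 ∂ν ≤ B)
    (h₂ : ∀ y, 0 < y → ν (Iic y) * ∫⁻ x in Ici y, ENNReal.ofReal x⁻¹ ^ 2 ∂μ ≤ B) :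
    ∫⁻ x, ∫⁻ y, ENNReal.ofReal (x + y)⁻¹ ∂ν ∂μ
      ≤ 2 * ((2 * B) ^ ((1:ℝ)/2) * (μ univ * ν univ) ^ ((1:ℝ)/2)) := by
  have hk : Measurable fun y : ℝ => ENNReal.ofReal y⁻¹ := by fun_prop
  have hmeas : Measurable fun x => ∫⁻ y in Ici x, ENNReal.ofReal y⁻¹ ∂ν :=
    Antitone.measurable fun _ _ h => lintegral_mono_set (Ici_subset_Ici.2 h)
  have hle : ∀ x, 0 < x → ∀ y, 0 < y → ENNReal.ofReal (x + y)⁻¹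
      ≤ (Ici x).indicator (fun y => ENNReal.ofReal y⁻¹) y
        + (Iic x).indicator (fun _ => ENNReal.ofReal x⁻¹) y := by
    intro x hx y hy
    rcases le_total x y with hxy | hxy
    · rw [indicator_of_mem (mem_Ici.2 hxy)]
      exact le_add_right (by gcongr; linarith)
    · rw [indicator_of_mem (mem_Iic.2 hxy)]
      exact le_add_left (by gcongr; linarith)
  have e₁ := lintegral_measure_Iic_mul_le μ ν hk (hμ.mono h₁)
  have e₂ := lintegral_measure_Iic_mul_le ν μ hk (hν.mono h₂)
  have hswap : ∫⁻ y, μ (Iic y) * ENNReal.ofReal y⁻¹ ∂ν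
      = ∫⁻ x, ∫⁻ y in Ici x, ENNReal.ofReal y⁻¹ ∂ν ∂μ := by
    simpa using lintegral_Iic_swap μ ν (f := fun _ => 1) measurable_const hk
  calc ∫⁻ x, ∫⁻ y, ENNReal.ofReal (x + y)⁻¹ ∂ν ∂μ
      ≤ ∫⁻ x, (∫⁻ y in Ici x, ENNReal.ofReal y⁻¹ ∂ν) + ν (Iic x) * ENNReal.ofReal x⁻¹ ∂μ := by
        refine lintegral_mono_ae (hμ.mono fun x hx => ?_)
        refine (lintegral_mono_ae (hν.mono fun y hy => hle x hx y hy)).trans_eq ?_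
        rw [lintegral_add_left (hk.indicator measurableSet_Ici),
          lintegral_indicator measurableSet_Ici, lintegral_indicator measurableSet_Iic,
          setLIntegral_const, mul_comm (ν _)]
    _ = ∫⁻ y, μ (Iic y) * ENNReal.ofReal y⁻¹ ∂ν + ∫⁻ x, ν (Iic x) * ENNReal.ofReal x⁻¹ ∂μ := by
        rw [lintegral_add_left hmeas, hswap]
    _ ≤ 2 * ((2 * B) ^ ((1:ℝ)/2) * (μ univ * ν univ) ^ ((1:ℝ)/2)) := by
        rw [mul_comm (ν univ)] at e₂
        rw [two_mul (_ * _)]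
        exact add_le_add e₁ e₂

theorem le_poisson_of_Icc (ν : Measure ℝ) {c d : ℝ} :
    ENNReal.ofReal (d - c)⁻¹ * ν (Icc c d) ≤ poisson ν c d := by
  rw [← setLIntegral_const, poisson]
  refine (setLIntegral_mono_ae' measurableSet_Icc (ae_of_all _ fun x hx => ?_)).trans
    (setLIntegral_le_lintegral (Icc c d) _)
  rw [Metric.infDist_zero_of_mem hx, add_zero]
  refine le_of_eq (congrArg _ ?_)
  rw [sq, div_self_mul_self']

theorem le_poisson_of_far (ν : Measure ℝ) {c d : ℝ} (hcd : c < d) (h0 : (0 : ℝ) ∈ Icc c d)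
    {s : Set ℝ} (hs : MeasurableSet s) (hsd : ∀ y ∈ s, d - c ≤ |y|) :
    ENNReal.ofReal ((d - c) / 4) * ∫⁻ y in s, ENNReal.ofReal |y|⁻¹ ^ 2 ∂ν ≤ poisson ν c d := by
  rw [← lintegral_const_mul _ (by fun_prop), poisson]
  refine (setLIntegral_mono_ae' hs (ae_of_all _ fun y hy => ?_)).trans
    (setLIntegral_le_lintegral s _)
  have hy := hsd y hy
  have hd : 0 < d - c := sub_pos.2 hcd
  have hdist : Metric.infDist y (Icc c d) ≤ |y| := by
    simpa using Metric.infDist_le_dist_of_mem (x := y) h0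
  have hnn : 0 ≤ Metric.infDist y (Icc c d) := Metric.infDist_nonneg
  rw [← ENNReal.ofReal_pow (by positivity), ← ENNReal.ofReal_mul (by positivity)]
  refine ENNReal.ofReal_le_ofReal ?_
  calc (d - c) / 4 * |y|⁻¹ ^ 2 = (d - c) / (2 * |y|) ^ 2 := by ring
    _ ≤ (d - c) / ((d - c) + Metric.infDist y (Icc c d)) ^ 2 := by
        gcongr
        linarith

theorem A2Bound.measure_Icc_mul_lintegral_le {μ ν : Measure ℝ} {A : ℝ} (h : A2Bound μ ν A)
    {c d : ℝ} (hcd : c < d) (h0 : (0 : ℝ) ∈ Icc c d)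
    {s : Set ℝ} (hs : MeasurableSet s) (hsd : ∀ y ∈ s, d - c ≤ |y|) :
    μ (Icc c d) * ∫⁻ y in s, ENNReal.ofReal |y|⁻¹ ^ 2 ∂ν ≤ 4 * ENNReal.ofReal A ^ 2 := by
  have hd : 0 < d - c := sub_pos.2 hcd
  have key := (mul_le_mul' (le_poisson_of_Icc μ) (le_poisson_of_far ν hcd h0 hs hsd)).trans
    (h c d hcd.le)
  have hc : 4 * (ENNReal.ofReal (d - c)⁻¹ * ENNReal.ofReal ((d - c) / 4)) = 1 := by
    rw [← ENNReal.ofReal_mul (by positivity), ← ENNReal.ofReal_ofNat,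
      ← ENNReal.ofReal_mul (by norm_num), ← ENNReal.ofReal_one]
    congr 1
    field_simp
  calc μ (Icc c d) * ∫⁻ y in s, ENNReal.ofReal |y|⁻¹ ^ 2 ∂ν
      = 4 * (ENNReal.ofReal (d - c)⁻¹ * ENNReal.ofReal ((d - c) / 4)) *
          (μ (Icc c d) * ∫⁻ y in s, ENNReal.ofReal |y|⁻¹ ^ 2 ∂ν) := by rw [hc, one_mul]
    _ = 4 * (ENNReal.ofReal (d - c)⁻¹ * μ (Icc c d) *
          (ENNReal.ofReal ((d - c) / 4) * ∫⁻ y in s, ENNReal.ofReal |y|⁻¹ ^ 2 ∂ν)) := by ring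
    _ ≤ 4 * ENNReal.ofReal A ^ 2 := by gcongr

theorem A2Bound.symm {μ ν : Measure ℝ} {A : ℝ} (h : A2Bound μ ν A) : A2Bound ν μ A :=
  fun a b hab => mul_comm (poisson μ a b) _ ▸ h a b hab

/-- **Hardy-type inequality from A₂.** Let `ω` and `σ` be locally finite positive Borel
measures on `ℝ` having no point masses, with finite `A₂` constant `A`.  Then for all
`0 < a ≤ b`, `∫_{(-a,0)} ∫_{(0,b)} (y-x)⁻¹ dσ(y) dω(x) ≤ C·A·(ω((-a,0))·σ((0,b)))^{1/2}`. -/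
theorem hardy_inequality_from_A2 :
    ∃ C : ℝ, 0 < C ∧
      ∀ ω σ : Measure ℝ, IsLocallyFiniteMeasure ω → IsLocallyFiniteMeasure σ →
        (∀ x : ℝ, ω {x} = 0) → (∀ x : ℝ, σ {x} = 0) →
        ∀ A : ℝ, 0 ≤ A → A2Bound ω σ A →
        ∀ a b : ℝ, 0 < a → a ≤ b →
          (∫⁻ x in Set.Ioo (-a) 0, ∫⁻ y in Set.Ioo 0 b, ENNReal.ofReal ((y - x)⁻¹) ∂σ ∂ω)
            ≤ ENNReal.ofReal (C * A) *
                (ω (Set.Ioo (-a) 0) * σ (Set.Ioo 0 b)) ^ ((1:ℝ)/2) := by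
  refine ⟨2 * 8 ^ ((1:ℝ)/2), by positivity, ?_⟩
  intro ω σ _ _ _ _ A hA h a b _ _
  set μ : Measure ℝ := (ω.restrict (Ioo (-a) 0)).map (MeasurableEquiv.neg ℝ) with hμdef
  set ν : Measure ℝ := σ.restrict (Ioo 0 b)
  have hμ : ∀ᵐ x ∂μ, 0 < x := by
    rw [hμdef, ae_map_iff (MeasurableEquiv.neg ℝ).measurable.aemeasurable measurableSet_Ioi]
    filter_upwards [ae_restrict_mem measurableSet_Ioo] with x hx
    simpa using hx.2
  have hν : ∀ᵐ y ∂ν, 0 < y := by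
    filter_upwards [ae_restrict_mem measurableSet_Ioo] with y hy using hy.1
  have h₁ : ∀ x, 0 < x → μ (Iic x) * ∫⁻ y in Ici x, ENNReal.ofReal y⁻¹ ^ 2 ∂ν
      ≤ 4 * ENNReal.ofReal A ^ 2 := by
    intro x hx
    have hsd : ∀ y ∈ Ici x, (0 : ℝ) - -x ≤ |y| := fun y hy => by
      simpa using (mem_Ici.1 hy).trans (le_abs_self y)
    refine le_trans ?_ (h.measure_Icc_mul_lintegral_le (c := -x) (d := 0) (by linarith)
      ⟨by linarith, le_rfl⟩ measurableSet_Ici hsd)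
    gcongr ?_ * ?_
    · rw [hμdef, MeasurableEquiv.map_apply, Measure.restrict_apply
        ((MeasurableEquiv.neg ℝ).measurable measurableSet_Iic)]
      refine measure_mono fun z hz => ⟨?_, hz.2.2.le⟩
      have : -z ≤ x := hz.1
      linarith
    · calc ∫⁻ y in Ici x, ENNReal.ofReal y⁻¹ ^ 2 ∂ν
          ≤ ∫⁻ y in Ici x, ENNReal.ofReal y⁻¹ ^ 2 ∂σ :=
            lintegral_mono' (Measure.restrict_mono le_rfl Measure.restrict_le_self) le_rfl
        _ = ∫⁻ y in Ici x, ENNReal.ofReal |y|⁻¹ ^ 2 ∂σ :=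
            setLIntegral_congr_fun measurableSet_Ici fun y hy => by
              simp only [abs_of_pos (hx.trans_le hy)]
  have h₂ : ∀ y, 0 < y → ν (Iic y) * ∫⁻ x in Ici y, ENNReal.ofReal x⁻¹ ^ 2 ∂μ
      ≤ 4 * ENNReal.ofReal A ^ 2 := by
    intro y hy
    have hsd : ∀ x ∈ Iic (-y), y - 0 ≤ |x| := fun x hx => by
      have := neg_le_abs x
      have := mem_Iic.1 hx
      linarith
    refine le_trans ?_ (h.symm.measure_Icc_mul_lintegral_le hy
      ⟨le_rfl, hy.le⟩ measurableSet_Iic hsd)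
    gcongr ?_ * ?_
    · rw [Measure.restrict_apply measurableSet_Iic]
      exact measure_mono fun z hz => ⟨hz.2.1.le, hz.1⟩
    · have hpre : MeasurableEquiv.neg ℝ ⁻¹' Ici y = Iic (-y) := by
        ext z
        simp
      rw [hμdef, MeasurableEquiv.restrict_map, lintegral_map_equiv, hpre]
      calc ∫⁻ x in Iic (-y), ENNReal.ofReal (MeasurableEquiv.neg ℝ x)⁻¹ ^ 2
              ∂(ω.restrict (Ioo (-a) 0))
          ≤ ∫⁻ x in Iic (-y), ENNReal.ofReal (MeasurableEquiv.neg ℝ x)⁻¹ ^ 2 ∂ω :=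
            lintegral_mono' (Measure.restrict_mono le_rfl Measure.restrict_le_self) le_rfl
        _ = ∫⁻ x in Iic (-y), ENNReal.ofReal |x|⁻¹ ^ 2 ∂ω :=
            setLIntegral_congr_fun measurableSet_Iic fun x hx => by
              have hx : x < 0 := by
                have := mem_Iic.1 hx
                linarith
              simp only [abs_of_neg hx, MeasurableEquiv.neg_apply]
  have key := lintegral_inv_add_le μ ν hμ hν h₁ h₂
  have hμu : μ univ = ω (Ioo (-a) 0) := by
    rw [hμdef, MeasurableEquiv.map_apply, preimage_univ, Measure.restrict_apply_univ]
  rw [hμu, Measure.restrict_apply_univ, hμdef, lintegral_map_equiv] at key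
  simp only [MeasurableEquiv.neg_apply, neg_add_eq_sub] at key
  refine key.trans_eq ?_
  rw [← mul_assoc, ← mul_assoc 2 4]
  congr 1
  rw [ENNReal.mul_rpow_of_nonneg _ _ (by norm_num), ← ENNReal.rpow_natCast, ← ENNReal.rpow_mul,
    mul_assoc 2, ENNReal.ofReal_mul (by norm_num), ENNReal.ofReal_mul (by positivity),
    ← ENNReal.ofReal_rpow_of_nonneg (by norm_num) (by norm_num)]
  norm_num
end

section
/- Let ω be a locally finite positive Borel measure on ℝ, let 0 ≤ ϵ ≤ 2, let I₀ be a bounded interval, and let {I_r}_{r≥1} be a countable family of pairwise disjoint intervals with I₀ = ⋃_{r≥1} I_r. Then Σ_{r≥1} ω(I_r) |I_r|^ϵ E(I_r, ω)^ϵ ≤ ω(I₀) |I₀|^ϵ E(I₀, ω)^ϵ. -/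
open MeasureTheory Set ENNReal

/-- The square `E(S,ν)²` of the energy of a bounded interval given as a set `S`, whose length
is `sSup S - sInf S`. -/
noncomputable def energySqSet (ν : Measure ℝ) (S : Set ℝ) : ℝ≥0∞ :=
  (∫⁻ x in S, ∫⁻ y in S,
      ENNReal.ofReal (((x - y) / (sSup S - sInf S)) ^ 2) ∂ν ∂ν) / (2 * ν S ^ 2)

/-- The double integral of `(x - y)²` over `S × S`. -/
noncomputable def pairSq (ν : Measure ℝ) (S : Set ℝ) : ℝ≥0∞ :=
  ∫⁻ x in S, ∫⁻ y in S, ENNReal.ofReal ((x - y) ^ 2) ∂ν ∂ν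

lemma pairSq_of_subsingleton (ν : Measure ℝ) {S : Set ℝ} (hS : S.Subsingleton) :
    pairSq ν S = 0 := by
  have hm : MeasurableSet S := hS.measurableSet
  have h : ∀ x ∈ S, ∫⁻ y in S, ENNReal.ofReal ((x - y) ^ 2) ∂ν = 0 := fun x hx => by
    rw [setLIntegral_congr_fun (g := fun _ => 0) hm fun y hy => by simp [hS hx hy]]
    simp
  rw [pairSq, setLIntegral_congr_fun (g := fun _ => 0) hm h]
  simp

lemma energySqSet_eq_pairSq (ν : Measure ℝ) (S : Set ℝ) :
    energySqSet ν S =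
      ENNReal.ofReal (((sSup S - sInf S) ^ 2)⁻¹) * (pairSq ν S / (2 * ν S ^ 2)) := by
  have h : ∀ x y : ℝ, ENNReal.ofReal (((x - y) / (sSup S - sInf S)) ^ 2) =
      ENNReal.ofReal (((sSup S - sInf S) ^ 2)⁻¹) * ENNReal.ofReal ((x - y) ^ 2) := fun x y => by
    rw [← ENNReal.ofReal_mul (by positivity), div_pow, div_eq_inv_mul]
  simp only [energySqSet, h, lintegral_const_mul' _ _ ENNReal.ofReal_ne_top, pairSq]
  rw [mul_div_assoc]

/-- The length of a bounded set cancels in `ν(S) |S|^ϵ E(S,ν)^ϵ`. -/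
lemma measure_mul_length_rpow_mul_energySqSet_rpow (ν : Measure ℝ) {S : Set ℝ}
    (hS : Bornology.IsBounded S) {ϵ : ℝ} (hϵ : 0 ≤ ϵ) :
    ν S * ENNReal.ofReal ((sSup S - sInf S) ^ ϵ) * energySqSet ν S ^ (ϵ / 2) =
      ν S * (pairSq ν S / (2 * ν S ^ 2)) ^ (ϵ / 2) := by
  rcases S.subsingleton_or_nontrivial with hs | hs
  · rcases hϵ.eq_or_lt with rfl | hϵ
    · simp
    · have : 0 < ϵ / 2 := by positivity
      simp [energySqSet_eq_pairSq, pairSq_of_subsingleton ν hs, ENNReal.zero_rpow_of_pos this]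
  · have hL : 0 < sSup S - sInf S := by
      obtain ⟨x, hx, y, hy, hxy⟩ := hs.exists_lt
      have h1 := le_csSup hS.bddAbove hy
      have h2 := csInf_le hS.bddBelow hx
      linarith
    rw [energySqSet_eq_pairSq, ENNReal.mul_rpow_of_nonneg _ _ (by positivity), mul_assoc,
      ← mul_assoc (ENNReal.ofReal _)]
    rw [ENNReal.ofReal_rpow_of_pos (by positivity), ← ENNReal.ofReal_mul (by positivity),
      Real.inv_rpow (by positivity), ← Real.rpow_natCast_mul hL.le]
    have : ((2 : ℕ) : ℝ) * (ϵ / 2) = ϵ := by push_cast; ring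
    rw [this, mul_inv_cancel₀ (by positivity), ENNReal.ofReal_one, one_mul]

section Moments

variable {μ : Measure ℝ} [IsFiniteMeasure μ]

lemma integrable_sub_sq (h1 : Integrable (fun x => x) μ) (h2 : Integrable (fun x => x ^ 2) μ)
    (c : ℝ) : Integrable (fun x => (x - c) ^ 2) μ := by
  have h3 : Integrable (fun x => x ^ 2 - 2 * c * x) μ := h2.sub (h1.const_mul _)
  refine (h3.add (integrable_const (c ^ 2))).congr (.of_forall fun x => ?_)
  simp only [Pi.add_apply]
  ring

lemma integral_sub_sq (h1 : Integrable (fun x => x) μ) (h2 : Integrable (fun x => x ^ 2) μ)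
    (c : ℝ) : ∫ x, (x - c) ^ 2 ∂μ =
      ∫ x, x ^ 2 ∂μ - 2 * c * ∫ x, x ∂μ + c ^ 2 * μ.real univ := by
  have he : (fun x : ℝ => (x - c) ^ 2) = fun x => x ^ 2 - 2 * c * x + c ^ 2 := by
    ext x; ring
  have h3 : Integrable (fun x => 2 * c * x) μ := h1.const_mul _
  have h4 : Integrable (fun x => x ^ 2 - 2 * c * x) μ := h2.sub h3
  rw [he, integral_add h4 (integrable_const _), integral_sub h2 h3, integral_const_mul,
    integral_const, smul_eq_mul, mul_comm (c ^ 2)]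

lemma lintegral_sub_sq (h1 : Integrable (fun x => x) μ) (h2 : Integrable (fun x => x ^ 2) μ)
    (c : ℝ) : ∫⁻ x, ENNReal.ofReal ((x - c) ^ 2) ∂μ =
      ENNReal.ofReal (∫ x, x ^ 2 ∂μ - 2 * c * ∫ x, x ∂μ + c ^ 2 * μ.real univ) := by
  rw [← ofReal_integral_eq_lintegral_ofReal (integrable_sub_sq h1 h2 c)
    (.of_forall fun x => sq_nonneg _), integral_sub_sq h1 h2]

lemma lintegral_lintegral_sub_sq (h1 : Integrable (fun x => x) μ)
    (h2 : Integrable (fun x => x ^ 2) μ) :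
    ∫⁻ x, ∫⁻ y, ENNReal.ofReal ((x - y) ^ 2) ∂μ ∂μ =
      ENNReal.ofReal (2 * (μ.real univ * ∫ x, x ^ 2 ∂μ - (∫ x, x ∂μ) ^ 2)) := by
  have hc : ∀ x, ∫⁻ y, ENNReal.ofReal ((x - y) ^ 2) ∂μ = ENNReal.ofReal
      (∫ y, y ^ 2 ∂μ - 2 * x * ∫ y, y ∂μ + x ^ 2 * μ.real univ) := fun x => by
    simp_rw [← lintegral_sub_sq h1 h2 x, sub_sq_comm x]
  have hnn : ∀ x : ℝ, 0 ≤ ∫ y, y ^ 2 ∂μ - 2 * x * ∫ y, y ∂μ + x ^ 2 * μ.real univ := fun x => by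
    rw [← integral_sub_sq h1 h2]
    exact integral_nonneg fun y => sq_nonneg _
  simp_rw [hc]
  have h3 : Integrable (fun x => 2 * x * ∫ y, y ∂μ) μ := (h1.const_mul 2).mul_const _
  have h4 : Integrable (fun x => x ^ 2 * μ.real univ) μ := h2.mul_const _
  have h5 : Integrable (fun x => ∫ y, y ^ 2 ∂μ - 2 * x * ∫ y, y ∂μ) μ :=
    (integrable_const _).sub h3
  have h6 : Integrable
      (fun x => ∫ y, y ^ 2 ∂μ - 2 * x * ∫ y, y ∂μ + x ^ 2 * μ.real univ) μ := h5.add h4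
  rw [← ofReal_integral_eq_lintegral_ofReal h6 (.of_forall hnn), integral_add h5 h4,
    integral_sub (integrable_const _) h3, integral_const, integral_mul_const, integral_mul_const,
    integral_const_mul, smul_eq_mul]
  congr 1
  ring

lemma lintegral_lintegral_sub_sq_le (h1 : Integrable (fun x => x) μ)
    (h2 : Integrable (fun x => x ^ 2) μ) (c : ℝ) :
    ∫⁻ x, ∫⁻ y, ENNReal.ofReal ((x - y) ^ 2) ∂μ ∂μ ≤
      2 * μ univ * ∫⁻ x, ENNReal.ofReal ((x - c) ^ 2) ∂μ := by
  rw [lintegral_lintegral_sub_sq h1 h2, lintegral_sub_sq h1 h2, ← ofReal_measureReal,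
    ← ENNReal.ofReal_ofNat 2, ← ENNReal.ofReal_mul (by positivity),
    ← ENNReal.ofReal_mul (by positivity)]
  refine ENNReal.ofReal_le_ofReal ?_
  nlinarith [sq_nonneg (∫ x, x ∂μ - c * μ.real univ)]

lemma exists_lintegral_lintegral_sub_sq_eq (h1 : Integrable (fun x => x) μ)
    (h2 : Integrable (fun x => x ^ 2) μ) (hμ : μ ≠ 0) :
    ∃ c : ℝ, ∫⁻ x, ∫⁻ y, ENNReal.ofReal ((x - y) ^ 2) ∂μ ∂μ =
      2 * μ univ * ∫⁻ x, ENNReal.ofReal ((x - c) ^ 2) ∂μ := by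
  have hm : μ.real univ ≠ 0 := by
    simpa [Measure.real, ENNReal.toReal_eq_zero_iff] using hμ
  refine ⟨(∫ x, x ∂μ) / μ.real univ, ?_⟩
  rw [lintegral_lintegral_sub_sq h1 h2, lintegral_sub_sq h1 h2, ← ofReal_measureReal,
    ← ENNReal.ofReal_ofNat 2, ← ENNReal.ofReal_mul (by positivity),
    ← ENNReal.ofReal_mul (by positivity)]
  congr 1
  field_simp
  ring

end Moments

lemma Bornology.IsBounded.integrable_restrict_of_continuous {ω : Measure ℝ}
    [IsLocallyFiniteMeasure ω] {S : Set ℝ} (hS : Bornology.IsBounded S) {f : ℝ → ℝ}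
    (hf : Continuous f) : Integrable f (ω.restrict S) :=
  (hf.continuousOn.integrableOn_compact hS.isCompact_closure).mono_set subset_closure

/-- Hölder's inequality for series, in the form of concavity of `t ↦ t ^ p`. -/
lemma tsum_mul_rpow_le (m V : ℕ → ℝ≥0∞) {p : ℝ} (hp0 : 0 ≤ p) (hp1 : p ≤ 1) :
    ∑' r, m r * V r ^ p ≤ (∑' r, m r) ^ (1 - p) * (∑' r, m r * V r) ^ p := by
  have hp : 0 ≤ 1 - p := sub_nonneg.2 hp1
  have h := ENNReal.lintegral_mul_norm_pow_le (μ := Measure.count) (f := m)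
    (g := fun r => m r * V r) (measurable_of_countable _).aemeasurable
    (measurable_of_countable _).aemeasurable hp hp0 (sub_add_cancel 1 p)
  simp only [lintegral_count] at h
  refine le_trans (ENNReal.tsum_le_tsum fun r => ?_) h
  rw [ENNReal.mul_rpow_of_nonneg _ _ hp0, ← mul_assoc, ← ENNReal.rpow_add_of_nonneg _ _ hp hp0,
    sub_add_cancel, ENNReal.rpow_one]

/-- **Monotonicity of energy.** Let `ω` be a locally finite positive Borel measure on `ℝ`,
let `0 ≤ ϵ ≤ 2`, let `I₀` be a bounded interval, and let `{I_r}` be a countable family of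
pairwise disjoint intervals with `I₀ = ⋃_r I_r`.  Then
`Σ_r ω(I_r) |I_r|^ϵ E(I_r,ω)^ϵ ≤ ω(I₀) |I₀|^ϵ E(I₀,ω)^ϵ`. -/
theorem energy_monotonicity
    (ω : Measure ℝ) [IsLocallyFiniteMeasure ω]
    (ϵ : ℝ) (hϵ0 : 0 ≤ ϵ) (hϵ2 : ϵ ≤ 2)
    (I₀ : Set ℝ) (hI₀ : I₀.OrdConnected) (hI₀b : Bornology.IsBounded I₀)
    (I : ℕ → Set ℝ) (hI : ∀ r, (I r).OrdConnected)
    (hdisj : Pairwise fun r s => Disjoint (I r) (I s))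
    (hunion : I₀ = ⋃ r, I r) :
    ∑' r : ℕ, ω (I r) * ENNReal.ofReal ((sSup (I r) - sInf (I r)) ^ ϵ) *
        energySqSet ω (I r) ^ (ϵ / 2)
      ≤ ω I₀ * ENNReal.ofReal ((sSup I₀ - sInf I₀) ^ ϵ) * energySqSet ω I₀ ^ (ϵ / 2) := by
  have hIb : ∀ r, Bornology.IsBounded (I r) := fun r =>
    hI₀b.subset (hunion ▸ subset_iUnion I r)
  have hfin : ∀ {S : Set ℝ}, Bornology.IsBounded S → ω S ≠ ∞ := fun hS => hS.measure_lt_top.ne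
  rw [measure_mul_length_rpow_mul_energySqSet_rpow ω hI₀b hϵ0]
  simp_rw [fun r => measure_mul_length_rpow_mul_energySqSet_rpow ω (hIb r) hϵ0]
  have hp0 : 0 ≤ ϵ / 2 := by positivity
  have hp1 : ϵ / 2 ≤ 1 := by linarith
  generalize ϵ / 2 = p at hp0 hp1
  have hsum : ω I₀ = ∑' r, ω (I r) := by
    rw [hunion, measure_iUnion hdisj fun r => (hI r).measurableSet]
  rcases eq_or_ne (ω I₀) 0 with h0 | h0
  · have : ∀ r, ω (I r) = 0 := ENNReal.tsum_eq_zero.1 (hsum ▸ h0)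
    simp [this]
  have : Fact (ω I₀ < ∞) := ⟨(hfin hI₀b).lt_top⟩
  obtain ⟨c, hc⟩ := exists_lintegral_lintegral_sub_sq_eq (μ := ω.restrict I₀)
    (hI₀b.integrable_restrict_of_continuous continuous_id')
    (hI₀b.integrable_restrict_of_continuous (continuous_pow 2))
    (by simpa using h0)
  rw [Measure.restrict_apply_univ] at hc
  have hle : ∀ r, ω (I r) * (pairSq ω (I r) / (2 * ω (I r) ^ 2)) ≤
      ∫⁻ x in I r, ENNReal.ofReal ((x - c) ^ 2) ∂ω := fun r => by
    have : Fact (ω (I r) < ∞) := ⟨(hfin (hIb r)).lt_top⟩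
    have h := lintegral_lintegral_sub_sq_le (μ := ω.restrict (I r))
      ((hIb r).integrable_restrict_of_continuous continuous_id')
      ((hIb r).integrable_restrict_of_continuous (continuous_pow 2)) c
    rw [Measure.restrict_apply_univ] at h
    rcases eq_or_ne (ω (I r)) 0 with hr | hr
    · simp [hr]
    calc ω (I r) * (pairSq ω (I r) / (2 * ω (I r) ^ 2))
        = pairSq ω (I r) / (2 * ω (I r)) := by
          rw [pow_two, ← mul_assoc, mul_comm (2 * ω (I r)), ← mul_div_assoc,
            ENNReal.mul_div_mul_left _ _ hr (hfin (hIb r))]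
      _ ≤ _ := ENNReal.div_le_of_le_mul' h
  have heq : ω I₀ * (pairSq ω I₀ / (2 * ω I₀ ^ 2)) =
      ∫⁻ x in I₀, ENNReal.ofReal ((x - c) ^ 2) ∂ω := by
    rw [pow_two, ← mul_assoc, mul_comm (2 * ω I₀), ← mul_div_assoc,
      ENNReal.mul_div_mul_left _ _ h0 (hfin hI₀b), pairSq, hc, mul_comm (2 * ω I₀),
      ENNReal.mul_div_cancel_right (by simp [h0])
        (ENNReal.mul_ne_top ENNReal.ofNat_ne_top (hfin hI₀b))]
  calc ∑' r, ω (I r) * (pairSq ω (I r) / (2 * ω (I r) ^ 2)) ^ p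
      ≤ (∑' r, ω (I r)) ^ (1 - p) *
          (∑' r, ω (I r) * (pairSq ω (I r) / (2 * ω (I r) ^ 2))) ^ p :=
        tsum_mul_rpow_le _ _ hp0 hp1
    _ ≤ ω I₀ ^ (1 - p) * (∑' r, ∫⁻ x in I r, ENNReal.ofReal ((x - c) ^ 2) ∂ω) ^ p := by
        rw [hsum]
        gcongr with r
        exact hle r
    _ = ω I₀ ^ (1 - p) * (ω I₀ * (pairSq ω I₀ / (2 * ω I₀ ^ 2))) ^ p := by
        rw [heq, hunion, lintegral_iUnion (fun r => (hI r).measurableSet) hdisj]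
    _ = ω I₀ * (pairSq ω I₀ / (2 * ω I₀ ^ 2)) ^ p := by
        rw [ENNReal.mul_rpow_of_nonneg _ _ hp0, ← mul_assoc,
          ← ENNReal.rpow_add_of_nonneg _ _ (sub_nonneg.2 hp1) hp0, sub_add_cancel,
          ENNReal.rpow_one]
end

section
/- Fix 0 < ε < 1. There is a constant C depending only on ε with the following property: for every integer r ≥ 1 and every interval J ⊂ ℝ whose length is an integer power of 2, the probability that J is r-bad with respect to the random dyadic grid 𝔻_β is at most C·2^{−εr}; that is, ℙ( { β ∈ {0,1}^ℤ : there exists I ∈ 𝔻_β with |I| ≥ 2^r |J| and dist(e(I), J) ≤ (1/2)|J|^ε |I|^{1−ε} } ) ≤ C·2^{−εr}. -/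
open MeasureTheory Set ENNReal

/-- The distance from the set `J` to the set `e([a,b])` consisting of the endpoints and
midpoint of the interval `[a,b]`. -/
noncomputable def distToEnds (J : Set ℝ) (a b : ℝ) : ℝ :=
  min (Metric.infDist a J) (min (Metric.infDist b J) (Metric.infDist ((a + b) / 2) J))

/-- The random translation `Σ_{i<n} 2^{i-n} β_i` of the grid `𝔻_β` at scale `2^n`. -/
noncomputable def gridShift (β : ℤ → Bool) (n : ℤ) : ℝ :=
  ∑' k : ℕ, (2:ℝ) ^ (-(k:ℤ) - 1) * (cond (β (n - (k:ℤ) - 1)) 1 0)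

/-- The number whose binary digits are the `N` bits `β ℓ, …, β (ℓ + N - 1)`. -/
def binaryBlock (β : ℤ → Bool) (ℓ : ℤ) (N : ℕ) : ℤ :=
  ∑ t ∈ Finset.range N, 2 ^ t * (cond (β (ℓ + t)) 1 0)

theorem binaryBlock_succ' (β : ℤ → Bool) (ℓ : ℤ) (N : ℕ) :
    binaryBlock β ℓ (N + 1) = cond (β ℓ) 1 0 + 2 * binaryBlock β (ℓ + 1) N := by
  simp only [binaryBlock, Finset.sum_range_succ', Finset.mul_sum]
  rw [add_comm]
  congr 1
  · simp
  · refine Finset.sum_congr rfl fun t _ => ?_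
    rw [show ℓ + ((t + 1 : ℕ) : ℤ) = ℓ + 1 + t by push_cast; ring]
    ring

/-- A block of `N` bits is determined by its binary value modulo `2 ^ N`. -/
theorem bits_eq_of_dvd_binaryBlock_sub (β γ : ℤ → Bool) (N : ℕ) : ∀ ℓ : ℤ,
    (2 : ℤ) ^ N ∣ binaryBlock β ℓ N - binaryBlock γ ℓ N →
      ∀ t < N, β (ℓ + t) = γ (ℓ + t) := by
  induction N with
  | zero => intro ℓ _ t ht; omega
  | succ N ih =>
    intro ℓ h t ht
    rw [binaryBlock_succ', binaryBlock_succ'] at h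
    obtain ⟨q, hq⟩ := h
    have h0 : β ℓ = γ ℓ := by
      rw [pow_succ, mul_comm _ (2 : ℤ), mul_assoc] at hq
      generalize (2 : ℤ) ^ N * q = w at hq
      cases hb : β ℓ <;> cases hc : γ ℓ <;> simp only [hb, hc, cond_true, cond_false] at hq ⊢ <;>
        omega
    rcases t with _ | t
    · simpa using h0
    · have := ih (ℓ + 1) ⟨q, by rw [h0, pow_succ] at hq; linarith⟩ t (by omega)
      rw [show ℓ + ((t + 1 : ℕ) : ℤ) = ℓ + 1 + t by push_cast; ring]
      exact this

theorem gridShift_term_eq (β : ℤ → Bool) (n : ℤ) (k : ℕ) :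
    (2 : ℝ) ^ (-(k : ℤ) - 1) * (cond (β (n - (k : ℤ) - 1)) 1 0)
      = 1 / 2 / 2 ^ k * (cond (β (n - (k : ℤ) - 1)) 1 0) := by
  congr 1
  rw [zpow_sub₀ two_ne_zero, zpow_neg, zpow_natCast, zpow_one]
  field_simp

theorem gridShift_term_nonneg (β : ℤ → Bool) (n : ℤ) (k : ℕ) :
    0 ≤ (2 : ℝ) ^ (-(k : ℤ) - 1) * (cond (β (n - (k : ℤ) - 1)) 1 0) := by
  cases β (n - (k : ℤ) - 1) <;> simp only [cond_true, cond_false] <;> positivity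

theorem gridShift_term_le (β : ℤ → Bool) (n : ℤ) (k : ℕ) :
    (2 : ℝ) ^ (-(k : ℤ) - 1) * (cond (β (n - (k : ℤ) - 1)) 1 0) ≤ 1 / 2 / 2 ^ k := by
  rw [gridShift_term_eq]
  cases β (n - (k : ℤ) - 1)
  · simp only [cond_false, mul_zero]; positivity
  · simp

theorem summable_gridShift (β : ℤ → Bool) (n : ℤ) :
    Summable fun k : ℕ => (2 : ℝ) ^ (-(k : ℤ) - 1) * (cond (β (n - (k : ℤ) - 1)) 1 0) :=
  (summable_geometric_two' 1).of_nonneg_of_le (gridShift_term_nonneg β n)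
    (gridShift_term_le β n)

theorem gridShift_nonneg (β : ℤ → Bool) (n : ℤ) : 0 ≤ gridShift β n :=
  tsum_nonneg (gridShift_term_nonneg β n)

theorem gridShift_le_one (β : ℤ → Bool) (n : ℤ) : gridShift β n ≤ 1 :=
  ((summable_gridShift β n).tsum_le_tsum (gridShift_term_le β n)
    (summable_geometric_two' 1)).trans_eq (tsum_geometric_two' 1)

theorem gridShift_succ (β : ℤ → Bool) (n : ℤ) :
    gridShift β (n + 1) = (cond (β n) 1 0 + gridShift β n) / 2 := by
  rw [gridShift, (summable_gridShift β (n + 1)).tsum_eq_zero_add, gridShift, add_div,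
    ← tsum_div_const]
  congr 1
  · cases h : β n <;> simp [h]
  · refine tsum_congr fun k => ?_
    rw [show n + 1 - ((k + 1 : ℕ) : ℤ) - 1 = n - k - 1 by push_cast; ring,
      show -((k + 1 : ℕ) : ℤ) - 1 = (-(k : ℤ) - 1) - 1 by push_cast; ring,
      zpow_sub_one₀ (two_ne_zero)]
    ring

/-- The first `N` binary digits of `gridShift β (ℓ + N)` are the bits of `β` from `ℓ` on. -/
theorem two_pow_mul_gridShift (β : ℤ → Bool) (ℓ : ℤ) (N : ℕ) :
    (2 : ℝ) ^ N * gridShift β (ℓ + N) = binaryBlock β ℓ N + gridShift β ℓ := by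
  induction N with
  | zero => simp [binaryBlock]
  | succ N ih =>
    rw [show ℓ + ((N + 1 : ℕ) : ℤ) = ℓ + N + 1 by push_cast; ring, gridShift_succ]
    have h : binaryBlock β ℓ (N + 1) = binaryBlock β ℓ N + 2 ^ N * cond (β (ℓ + N)) 1 0 :=
      Finset.sum_range_succ _ _
    rw [h, pow_succ]
    cases β (ℓ + N) <;> simp only [cond_true, cond_false] <;> push_cast <;> linarith

theorem mem_Icc_of_infDist_Icc_le {x a b δ : ℝ} (hab : a ≤ b)
    (h : Metric.infDist x (Set.Icc a b) ≤ δ) : x ∈ Set.Icc (a - δ) (b + δ) := by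
  obtain ⟨y, hy, hxy⟩ := isCompact_Icc.exists_infDist_eq_dist (Set.nonempty_Icc.2 hab) x
  rw [hxy, Real.dist_eq, abs_le] at h
  exact ⟨by linarith [hy.1], by linarith [hy.2]⟩

/-- If an endpoint or the midpoint of a grid interval of length `2 ^ (ℓ + N + 1)` is close to
`[c, c + 2 ^ ℓ]`, then the bits `β ℓ, …, β (ℓ + N - 1)` have, modulo `2 ^ N`, a binary value
in a short interval. -/
theorem exists_dvd_sub_binaryBlock (β : ℤ → Bool) (ℓ : ℤ) (N : ℕ) (m : ℤ) (c δ : ℝ)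
    (h : distToEnds (Set.Icc c (c + (2 : ℝ) ^ ℓ))
      ((2 : ℝ) ^ (ℓ + (N + 1 : ℕ)) * ((m : ℝ) + gridShift β (ℓ + (N + 1 : ℕ))))
      ((2 : ℝ) ^ (ℓ + (N + 1 : ℕ)) * ((m : ℝ) + 1 + gridShift β (ℓ + (N + 1 : ℕ))))
        ≤ 2 ^ ℓ * δ) :
    ∃ z ∈ Finset.Icc ⌈c / 2 ^ ℓ - δ - 1⌉ ⌊c / 2 ^ ℓ + 1 + δ⌋,
      (2 : ℤ) ^ N ∣ z - binaryBlock β ℓ N := by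
  have hL : (0 : ℝ) < 2 ^ ℓ := by positivity
  have key : ∀ k : ℤ, Metric.infDist
      ((2 : ℝ) ^ ℓ * (2 ^ N * k + binaryBlock β ℓ N + gridShift β ℓ))
      (Set.Icc c (c + (2 : ℝ) ^ ℓ)) ≤ 2 ^ ℓ * δ →
      ∃ z ∈ Finset.Icc ⌈c / 2 ^ ℓ - δ - 1⌉ ⌊c / 2 ^ ℓ + 1 + δ⌋,
      (2 : ℤ) ^ N ∣ z - binaryBlock β ℓ N := by
    intro k hk
    obtain ⟨h1, h2⟩ := mem_Icc_of_infDist_Icc_le (by linarith) hk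
    refine ⟨2 ^ N * k + binaryBlock β ℓ N, ?_, ⟨k, by ring⟩⟩
    have hc : c = 2 ^ ℓ * (c / 2 ^ ℓ) := by field_simp
    set a := c / (2 : ℝ) ^ ℓ
    have h3 : a - δ ≤ 2 ^ N * k + binaryBlock β ℓ N + gridShift β ℓ :=
      le_of_mul_le_mul_left (by linarith) hL
    have h4 : 2 ^ N * k + binaryBlock β ℓ N + gridShift β ℓ ≤ a + 1 + δ :=
      le_of_mul_le_mul_left (by linarith) hL
    rw [Finset.mem_Icc, Int.ceil_le, Int.le_floor]
    push_cast
    constructor <;> linarith [gridShift_nonneg β ℓ, gridShift_le_one β ℓ]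
  have hg : (2 : ℝ) ^ (N + 1) * gridShift β (ℓ + (N + 1 : ℕ))
      = 2 ^ N * ((cond (β (ℓ + N)) 1 0 : ℤ) : ℝ) + binaryBlock β ℓ N + gridShift β ℓ := by
    rw [two_pow_mul_gridShift, show binaryBlock β ℓ (N + 1)
      = binaryBlock β ℓ N + 2 ^ N * cond (β (ℓ + N)) 1 0 from Finset.sum_range_succ _ _]
    push_cast
    ring
  have hn : (2 : ℝ) ^ (ℓ + (N + 1 : ℕ)) = 2 ^ ℓ * 2 ^ (N + 1) := by
    rw [zpow_add₀ two_ne_zero, zpow_natCast]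
  set b : ℤ := cond (β (ℓ + N)) 1 0
  set g := gridShift β (ℓ + (N + 1 : ℕ))
  have e1 : (2 : ℝ) ^ (ℓ + (N + 1 : ℕ)) * (m + g) = (2 : ℝ) ^ ℓ *
      (2 ^ N * ((2 * m + b : ℤ) : ℝ) + binaryBlock β ℓ N + gridShift β ℓ) := by
    rw [hn, mul_assoc, mul_add, hg]; push_cast; ring
  have e2 : (2 : ℝ) ^ (ℓ + (N + 1 : ℕ)) * (m + 1 + g) = (2 : ℝ) ^ ℓ *
      (2 ^ N * ((2 * m + b + 2 : ℤ) : ℝ) + binaryBlock β ℓ N + gridShift β ℓ) := by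
    rw [hn, mul_assoc, mul_add, hg]; push_cast; ring
  have e3 : ((2 : ℝ) ^ (ℓ + (N + 1 : ℕ)) * (m + g) +
      (2 : ℝ) ^ (ℓ + (N + 1 : ℕ)) * (m + 1 + g)) / 2 = (2 : ℝ) ^ ℓ *
      (2 ^ N * ((2 * m + b + 1 : ℤ) : ℝ) + binaryBlock β ℓ N + gridShift β ℓ) := by
    rw [e1, e2]; push_cast; ring
  rw [distToEnds, e3, e1, e2, min_le_iff, min_le_iff] at h
  rcases h with h | h | h
  exacts [key _ h, key _ h, key _ h]

section Probability

variable {μ : Measure (ℤ → Bool)}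

theorem measure_dvd_sub_binaryBlock_le
    (hμ : ∀ (s : Finset ℤ) (v : ℤ → Bool),
      μ {β | ∀ i ∈ s, β i = v i} = (2 : ℝ≥0∞)⁻¹ ^ s.card) (ℓ : ℤ) (N : ℕ) (z : ℤ) :
    μ {β | (2 : ℤ) ^ N ∣ z - binaryBlock β ℓ N} ≤ (2 : ℝ≥0∞)⁻¹ ^ N := by
  rcases Set.eq_empty_or_nonempty {β | (2 : ℤ) ^ N ∣ z - binaryBlock β ℓ N} with h | ⟨γ, hγ⟩
  · simp [h]
  · have hcard : ((Finset.range N).image fun t : ℕ => ℓ + (t : ℤ)).card = N := by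
      rw [Finset.card_image_of_injective _ fun a b hab => by simpa using hab, Finset.card_range]
    have hs := hμ ((Finset.range N).image fun t : ℕ => ℓ + (t : ℤ)) γ
    rw [hcard] at hs
    rw [← hs]
    refine measure_mono fun β hβ => ?_
    simp only [Set.mem_ofPred_eq, Finset.mem_image, Finset.mem_range] at hβ hγ ⊢
    rintro _ ⟨t, ht, rfl⟩
    refine bits_eq_of_dvd_binaryBlock_sub β γ N ℓ ?_ t ht
    simpa only [_root_.sub_sub_sub_cancel_left] using dvd_sub hγ hβ

/-- The probability that a grid interval of the fixed length `2 ^ (ℓ + N + 1)` has an endpoint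
or its midpoint close to `[c, c + 2 ^ ℓ]`. -/
theorem measure_exists_distToEnds_le
    (hμ : ∀ (s : Finset ℤ) (v : ℤ → Bool),
      μ {β | ∀ i ∈ s, β i = v i} = (2 : ℝ≥0∞)⁻¹ ^ s.card) (ℓ : ℤ) (N : ℕ) (c : ℝ) {δ : ℝ}
    (hδ : 0 ≤ δ) :
    μ {β | ∃ m : ℤ, distToEnds (Set.Icc c (c + (2 : ℝ) ^ ℓ))
      ((2 : ℝ) ^ (ℓ + (N + 1 : ℕ)) * ((m : ℝ) + gridShift β (ℓ + (N + 1 : ℕ))))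
      ((2 : ℝ) ^ (ℓ + (N + 1 : ℕ)) * ((m : ℝ) + 1 + gridShift β (ℓ + (N + 1 : ℕ))))
        ≤ 2 ^ ℓ * δ} ≤ ENNReal.ofReal ((2 * δ + 3) / 2 ^ N) := by
  set S := Finset.Icc ⌈c / 2 ^ ℓ - δ - 1⌉ ⌊c / 2 ^ ℓ + 1 + δ⌋
  have hS : (S.card : ℝ) ≤ 2 * δ + 3 := by
    have h1 : ((S.card : ℤ) : ℝ) =
        ((max (⌊c / 2 ^ ℓ + 1 + δ⌋ + 1 - ⌈c / 2 ^ ℓ - δ - 1⌉) 0 : ℤ) : ℝ) := by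
      rw [Int.card_Icc, Int.toNat_eq_max]
    rw [← Int.cast_natCast, h1]
    push_cast
    refine max_le ?_ (by linarith)
    linarith [Int.floor_le (c / 2 ^ ℓ + 1 + δ), Int.le_ceil (c / 2 ^ ℓ - δ - 1)]
  calc
    _ ≤ μ (⋃ z ∈ S, {β | (2 : ℤ) ^ N ∣ z - binaryBlock β ℓ N}) := by
      refine measure_mono ?_
      rintro β ⟨m, hm⟩
      simpa only [Set.mem_iUnion, exists_prop, Set.mem_ofPred_eq] using exists_dvd_sub_binaryBlock β ℓ N m c δ hm
    _ ≤ ∑ z ∈ S, μ {β | (2 : ℤ) ^ N ∣ z - binaryBlock β ℓ N} := measure_biUnion_finset_le _ _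
    _ ≤ ∑ _z ∈ S, (2 : ℝ≥0∞)⁻¹ ^ N :=
      Finset.sum_le_sum fun z _ => measure_dvd_sub_binaryBlock_le hμ ℓ N z
    _ = ENNReal.ofReal (S.card / 2 ^ N) := by
      rw [Finset.sum_const, nsmul_eq_mul, div_eq_mul_inv, ENNReal.ofReal_mul (by positivity),
        ENNReal.ofReal_natCast, ← inv_pow, ENNReal.ofReal_pow (by positivity),
        ENNReal.ofReal_inv_of_pos two_pos, ENNReal.ofReal_ofNat]
    _ ≤ _ := ENNReal.ofReal_le_ofReal (by gcongr)

end Probability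

/-- **Bad intervals are rare.** Fix `0 < ε < 1`.  There is `C = C(ε)` such that for every
probability measure `ℙ` on `{0,1}^ℤ` whose coordinates are independent fair coin flips,
every `r ≥ 1` and every interval `J = [c, c+2^ℓ]` whose length is an integer power of `2`,
the probability that `J` is `r`-bad with respect to the random dyadic grid `𝔻_β`, i.e. that
there is `I ∈ 𝔻_β` with `|I| ≥ 2^r |J|` and `dist(e(I), J) ≤ (1/2)|J|^ε |I|^{1-ε}`,
is at most `C·2^{-εr}`. -/
theorem prob_bad_interval (ε : ℝ) (hε0 : 0 < ε) (hε1 : ε < 1) :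
    ∃ C : ℝ, 0 < C ∧
      ∀ ℙ : Measure (ℤ → Bool), IsProbabilityMeasure ℙ →
        (∀ (s : Finset ℤ) (v : ℤ → Bool),
          ℙ {β | ∀ i ∈ s, β i = v i} = (2:ℝ≥0∞)⁻¹ ^ s.card) →
      ∀ r : ℕ, 1 ≤ r → ∀ (c : ℝ) (ℓ : ℤ),
        ℙ {β : ℤ → Bool | ∃ n m : ℤ,
            (2:ℝ) ^ r * (2:ℝ) ^ ℓ ≤ (2:ℝ) ^ n ∧
            distToEnds (Set.Icc c (c + (2:ℝ) ^ ℓ))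
                ((2:ℝ) ^ n * ((m : ℝ) + gridShift β n))
                ((2:ℝ) ^ n * ((m : ℝ) + 1 + gridShift β n))
              ≤ (1/2) * ((2:ℝ) ^ ℓ) ^ ε * ((2:ℝ) ^ n) ^ (1 - ε)}
          ≤ ENNReal.ofReal (C * 2 ^ (-(ε * r))) := by
  set q : ℝ := 2 ^ (-ε) with hq
  have hq0 : 0 < q := by positivity
  have hq1 : q < 1 := Real.rpow_lt_one_of_one_lt_of_neg _root_.one_lt_two (by linarith)
  have hqpow : ∀ k : ℕ, (2 : ℝ) ^ (-(ε * k)) = q ^ k := fun k => by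
    rw [hq, ← Real.rpow_natCast, ← Real.rpow_mul zero_le_two, neg_mul]
  have hqhalf : ∀ k : ℕ, 1 ≤ 2 ^ k * q ^ k := fun k => by
    rw [← mul_pow]
    refine one_le_pow₀ ?_
    have : (2 : ℝ) * q = 2 ^ (1 - ε) := by
      rw [hq, sub_eq_add_neg, Real.rpow_add two_pos, Real.rpow_one]
    rw [this]
    exact Real.one_le_rpow one_le_two (by linarith)
  refine ⟨8 / (1 - q), div_pos (by norm_num) (by linarith), ?_⟩
  intro ℙ _ hℙ r hr c ℓ
  have hδ : ∀ k : ℕ, (1 / 2 : ℝ) * ((2 : ℝ) ^ ℓ) ^ ε * ((2 : ℝ) ^ (ℓ + (k : ℤ))) ^ (1 - ε)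
      = 2 ^ ℓ * (2 ^ k * q ^ k / 2) := fun k => by
    have hL : (0 : ℝ) < 2 ^ ℓ := by positivity
    have h1 : ((2 : ℝ) ^ ℓ) ^ ε * ((2 : ℝ) ^ ℓ) ^ (1 - ε) = 2 ^ ℓ := by
      rw [← Real.rpow_add hL, add_sub_cancel, Real.rpow_one]
    have h2 : ((2 : ℝ) ^ k) ^ (1 - ε) = 2 ^ k * q ^ k := by
      rw [← hqpow, Real.rpow_sub (by positivity), Real.rpow_one, div_eq_mul_inv,
        ← Real.rpow_neg (by positivity), ← Real.rpow_natCast, ← Real.rpow_mul zero_le_two]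
      ring_nf
    rw [zpow_add₀ two_ne_zero, zpow_natCast, Real.mul_rpow hL.le (by positivity), h2]
    linear_combination (2 ^ k * q ^ k / 2) * h1
  calc
    _ ≤ ℙ (⋃ j : ℕ, {β | ∃ m : ℤ, distToEnds (Set.Icc c (c + (2 : ℝ) ^ ℓ))
      ((2 : ℝ) ^ (ℓ + (r - 1 + j + 1 : ℕ)) * ((m : ℝ) + gridShift β (ℓ + (r - 1 + j + 1 : ℕ))))
      ((2 : ℝ) ^ (ℓ + (r - 1 + j + 1 : ℕ)) *
        ((m : ℝ) + 1 + gridShift β (ℓ + (r - 1 + j + 1 : ℕ))))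
        ≤ 2 ^ ℓ * (2 ^ (r - 1 + j + 1) * q ^ (r - 1 + j + 1) / 2)}) := by
      refine measure_mono ?_
      rintro β ⟨n, m, hn, hm⟩
      have hn' : (r : ℤ) + ℓ ≤ n := by
        rw [← zpow_natCast, ← zpow_add₀ two_ne_zero] at hn
        exact (zpow_le_zpow_iff_right₀ _root_.one_lt_two).1 hn
      obtain ⟨j, hj⟩ := Int.le.dest hn'
      obtain rfl : n = ℓ + (r - 1 + j + 1 : ℕ) := by omega
      rw [hδ] at hm
      exact Set.mem_iUnion.2 ⟨j, m, hm⟩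
    _ ≤ ∑' j : ℕ, _ := measure_iUnion_le _
    _ ≤ ∑' j : ℕ, ENNReal.ofReal (8 * q ^ r * q ^ j) := by
      refine ENNReal.tsum_le_tsum fun j => ?_
      refine (measure_exists_distToEnds_le hℙ ℓ (r - 1 + j) c (by positivity)).trans
        (ENNReal.ofReal_le_ofReal ?_)
      rw [mul_assoc, ← pow_add, show r + j = r - 1 + j + 1 by omega,
        div_le_iff₀ (by positivity)]
      have := hqhalf (r - 1 + j + 1)
      rw [pow_succ 2] at this ⊢
      linarith
    _ = ENNReal.ofReal (8 / (1 - q) * 2 ^ (-(ε * r))) := by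
      rw [← ENNReal.ofReal_tsum_of_nonneg (fun j => by positivity)
        ((summable_geometric_of_lt_one hq0.le hq1).mul_left _), tsum_mul_left,
        tsum_geometric_of_lt_one hq0.le hq1, hqpow]
      congr 1
      ring
end

section
/- Let ω be the Cantor measure on [0,1]. There exist absolute constants 0 < c ≤ C such that for every ℓ ≥ 0 and every 1 ≤ r ≤ 2^ℓ, c·(3/2)^ℓ ≤ P(I_r^ℓ, ω) ≤ C·(3/2)^ℓ and c·(3/2)^ℓ ≤ P(G_r^ℓ, ω) ≤ C·(3/2)^ℓ. -/
open MeasureTheory Set ENNReal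

/-- The left endpoint of the generation-`k` triadic interval of the middle-thirds Cantor
construction determined by the digits `d`. -/
noncomputable def cantorLeft (k : ℕ) (d : Fin k → Bool) : ℝ :=
  ∑ i : Fin k, (cond (d i) 2 0) / 3 ^ ((i : ℕ) + 1)

/-- The generation-`k` closed triadic interval `I_d^k`, of length `3^{-k}`. -/
noncomputable def cantorI (k : ℕ) (d : Fin k → Bool) : Set ℝ :=
  Set.Icc (cantorLeft k d) (cantorLeft k d + (1/3) ^ k)

/-- The left endpoint of the removed open middle third `G_d^k` of `I_d^k`. -/
noncomputable def gLeft (k : ℕ) (d : Fin k → Bool) : ℝ :=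
  cantorLeft k d + (1/3) ^ (k + 1)

/-- The right endpoint of the removed open middle third `G_d^k` of `I_d^k`. -/
noncomputable def gRight (k : ℕ) (d : Fin k → Bool) : ℝ :=
  cantorLeft k d + 2 * (1/3) ^ (k + 1)

/-- `ω` is the Cantor measure on `[0,1]`: the unique Borel probability measure with
`ω(I_d^k) = 2^{-k}` for every `k ≥ 0` and every generation-`k` triadic interval. -/
def IsCantorMeasure (ω : Measure ℝ) : Prop :=
  IsProbabilityMeasure ω ∧
  ∀ (k : ℕ) (d : Fin k → Bool), ω (cantorI k d) = (1/2 : ℝ≥0∞) ^ k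

theorem cantorLeft_snoc (k : ℕ) (d : Fin k → Bool) (b : Bool) :
    cantorLeft (k + 1) (Fin.snoc d b) = cantorLeft k d + cond b 2 0 * (1 / 3) ^ (k + 1) := by
  simp only [cantorLeft, Fin.sum_univ_castSucc, Fin.snoc_castSucc, Fin.snoc_last,
    Fin.val_castSucc, Fin.val_last]
  rw [one_div, inv_pow, ← div_eq_mul_inv]

theorem cantorI_snoc_subset (k : ℕ) (d : Fin k → Bool) (b : Bool) :
    cantorI (k + 1) (Fin.snoc d b) ⊆ cantorI k d := by
  have h : (0 : ℝ) < (1 / 3) ^ k := by positivity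
  intro x hx
  simp only [cantorI, cantorLeft_snoc, mem_Icc, pow_succ] at hx ⊢
  cases b <;> simp only [cond_true, cond_false] at hx <;> constructor <;> linarith [hx.1, hx.2]

theorem cantorI_nonempty (k : ℕ) (d : Fin k → Bool) : (cantorI k d).Nonempty :=
  nonempty_Icc.2 (by linarith [show (0 : ℝ) < (1 / 3) ^ k by positivity])

theorem measurableSet_cantorI (k : ℕ) (d : Fin k → Bool) : MeasurableSet (cantorI k d) :=
  measurableSet_Icc

/-- Points of the two children of a triadic interval are at least a child's length apart. -/
theorem le_dist_of_mem_cantorI_snoc (k : ℕ) (d : Fin k → Bool) {b : Bool} {x y : ℝ}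
    (hx : x ∈ cantorI (k + 1) (Fin.snoc d (!b))) (hy : y ∈ cantorI (k + 1) (Fin.snoc d b)) :
    (1 / 3 : ℝ) ^ (k + 1) ≤ dist x y := by
  simp only [cantorI, cantorLeft_snoc, mem_Icc] at hx hy
  rw [Real.dist_eq, le_abs]
  cases b <;> simp only [Bool.not_true, Bool.not_false, cond_true, cond_false] at hx hy
  · left; linarith [hx.1, hy.2]
  · right; linarith [hx.2, hy.1]

/-- The removed middle thirds are null sets of the Cantor measure. -/
theorem IsCantorMeasure.measure_gap {ω : Measure ℝ} (h : IsCantorMeasure ω) (k : ℕ)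
    (d : Fin k → Bool) (b : Bool) :
    ω (cantorI k d \ (cantorI (k + 1) (Fin.snoc d b) ∪ cantorI (k + 1) (Fin.snoc d (!b)))) = 0 := by
  have := h.1
  have hdisj : Disjoint (cantorI (k + 1) (Fin.snoc d b)) (cantorI (k + 1) (Fin.snoc d (!b))) := by
    refine Set.disjoint_left.2 fun x hx hx' => ?_
    have h1 := le_dist_of_mem_cantorI_snoc k d hx' hx
    rw [dist_self] at h1
    exact absurd h1 (not_le.2 (by positivity))
  rw [measure_sdiff (union_subset (cantorI_snoc_subset k d _) (cantorI_snoc_subset k d _))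
    ((measurableSet_cantorI _ _).union (measurableSet_cantorI _ _)).nullMeasurableSet
    (measure_ne_top _ _), measure_union hdisj (measurableSet_cantorI _ _), h.2, h.2, h.2,
    pow_succ, ← mul_add]
  simp [ENNReal.inv_two_add_inv_two]

theorem IsCantorMeasure.measure_cantorI {ω : Measure ℝ} (h : IsCantorMeasure ω) (k : ℕ)
    (d : Fin k → Bool) : ω (cantorI k d) = ENNReal.ofReal ((1 / 2) ^ k) := by
  rw [h.2, ENNReal.ofReal_pow (by norm_num), ENNReal.ofReal_div_of_pos (by norm_num)]
  simp

/-- The tail integral of the inverse squared distance to a triadic interval. -/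
theorem IsCantorMeasure.lintegral_compl_le {ω : Measure ℝ} (h : IsCantorMeasure ω) (k : ℕ)
    (d : Fin k → Bool) :
    ∫⁻ x in (cantorI k d)ᶜ, ENNReal.ofReal (1 / Metric.infDist x (cantorI k d) ^ 2) ∂ω
      ≤ ENNReal.ofReal (3 * (9 / 2) ^ k) := by
  have := h.1
  induction k with
  | zero =>
    have h0 : ω (cantorI 0 d)ᶜ = 0 := by
      rw [prob_compl_eq_zero_iff (measurableSet_cantorI _ _), h.2, pow_zero]
    rw [Measure.restrict_eq_zero.2 h0]
    simp
  | succ k ih =>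
    obtain ⟨e, b, rfl⟩ : ∃ (e : Fin k → Bool) (b : Bool), d = Fin.snoc e b :=
      ⟨Fin.init d, d (Fin.last k), (Fin.snoc_init_self d).symm⟩
    set J := cantorI (k + 1) (Fin.snoc e b) with hJ
    have hJI : J ⊆ cantorI k e := cantorI_snoc_subset k e b
    have hcompl : Jᶜ ⊆ (cantorI k e)ᶜ ∪ cantorI k e \ J := by
      intro x hx
      by_cases hxI : x ∈ cantorI k e
      · exact Or.inr ⟨hxI, hx⟩
      · exact Or.inl hxI
    have hfar : ∫⁻ x in (cantorI k e)ᶜ, ENNReal.ofReal (1 / Metric.infDist x J ^ 2) ∂ω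
        ≤ ENNReal.ofReal (3 * (9 / 2) ^ k) := by
      refine (setLIntegral_mono' (measurableSet_cantorI k e).compl fun x hx => ?_).trans (ih e)
      have hpos : 0 < Metric.infDist x (cantorI k e) :=
        (isClosed_Icc.notMem_iff_infDist_pos (cantorI_nonempty k e)).1 hx
      have hle := Metric.infDist_le_infDist_of_subset (x := x) hJI (cantorI_nonempty _ _)
      gcongr
    have hnear : ∫⁻ x in cantorI k e \ J, ENNReal.ofReal (1 / Metric.infDist x J ^ 2) ∂ω
        ≤ ENNReal.ofReal (9 * (9 / 2) ^ k) := by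
      have hae : ∀ᵐ x ∂ω, x ∈ cantorI k e \ J →
          ENNReal.ofReal (1 / Metric.infDist x J ^ 2) ≤ ENNReal.ofReal (9 ^ (k + 1)) := by
        filter_upwards [measure_eq_zero_iff_ae_notMem.1 (h.measure_gap k e b)] with x hx hxJ
        have hsib : x ∈ cantorI (k + 1) (Fin.snoc e (!b)) := by
          by_contra hns
          exact hx ⟨hxJ.1, fun hu => hu.elim hxJ.2 hns⟩
        have hd : (1 / 3 : ℝ) ^ (k + 1) ≤ Metric.infDist x J :=
          (Metric.le_infDist (cantorI_nonempty _ _)).2 fun y hy =>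
            le_dist_of_mem_cantorI_snoc k e hsib hy
        refine ENNReal.ofReal_le_ofReal ?_
        calc 1 / Metric.infDist x J ^ 2 ≤ 1 / ((1 / 3 : ℝ) ^ (k + 1)) ^ 2 := by gcongr
          _ = 9 ^ (k + 1) := by
            rw [← pow_mul, mul_comm, pow_mul, one_div, ← inv_pow]; norm_num
      calc _ ≤ ∫⁻ _ in cantorI k e \ J, ENNReal.ofReal (9 ^ (k + 1)) ∂ω :=
            setLIntegral_mono_ae' ((measurableSet_cantorI _ _).diff (measurableSet_cantorI _ _)) hae
        _ ≤ ENNReal.ofReal (9 ^ (k + 1)) * ω (cantorI k e) := by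
            rw [setLIntegral_const]; gcongr; exact sdiff_subset
        _ = ENNReal.ofReal (9 * (9 / 2) ^ k) := by
            rw [h.measure_cantorI, ← ENNReal.ofReal_mul (by positivity), pow_succ', mul_assoc,
              ← mul_pow]
            norm_num
    calc _ ≤ _ := lintegral_mono_set hcompl
      _ ≤ _ := lintegral_union_le _ _ _
      _ ≤ _ := add_le_add hfar hnear
      _ ≤ ENNReal.ofReal (3 * (9 / 2) ^ (k + 1)) := by
        rw [← ENNReal.ofReal_add (by positivity) (by positivity)]
        refine ENNReal.ofReal_le_ofReal ?_
        rw [pow_succ]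
        linarith [show (0 : ℝ) < (9 / 2) ^ k by positivity]

theorem IsCantorMeasure.poisson_le {ω : Measure ℝ} (h : IsCantorMeasure ω) {k : ℕ}
    {d : Fin k → Bool} {a b : ℝ} (hsub : Icc a b ⊆ cantorI k d)
    (hlow : (1 / 3) ^ (k + 1) ≤ b - a) (hup : b - a ≤ (1 / 3) ^ k) :
    poisson ω a b ≤ ENNReal.ofReal (6 * (3 / 2) ^ k) := by
  have hL : 0 < b - a := lt_of_lt_of_le (by positivity) hlow
  have hin : ∫⁻ x in cantorI k d,
      ENNReal.ofReal ((b - a) / ((b - a) + Metric.infDist x (Icc a b)) ^ 2) ∂ω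
      ≤ ENNReal.ofReal (3 * (3 / 2) ^ k) := by
    calc _ ≤ ∫⁻ _ in cantorI k d, ENNReal.ofReal (3 ^ (k + 1)) ∂ω := by
          refine lintegral_mono fun x => ENNReal.ofReal_le_ofReal ?_
          have hD : 0 ≤ Metric.infDist x (Icc a b) := Metric.infDist_nonneg
          calc _ ≤ (b - a) / (b - a) ^ 2 := by gcongr; linarith
            _ = 1 / (b - a) := by field_simp
            _ ≤ 1 / (1 / 3) ^ (k + 1) := by gcongr
            _ = 3 ^ (k + 1) := by simp
      _ = ENNReal.ofReal (3 * (3 / 2) ^ k) := by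
          rw [setLIntegral_const, h.measure_cantorI, ← ENNReal.ofReal_mul (by positivity),
            pow_succ', mul_assoc, ← mul_pow]
          norm_num
  have hout : ∫⁻ x in (cantorI k d)ᶜ,
      ENNReal.ofReal ((b - a) / ((b - a) + Metric.infDist x (Icc a b)) ^ 2) ∂ω
      ≤ ENNReal.ofReal (3 * (3 / 2) ^ k) := by
    calc _ ≤ ∫⁻ x in (cantorI k d)ᶜ, ENNReal.ofReal ((1 / 3) ^ k) *
            ENNReal.ofReal (1 / Metric.infDist x (cantorI k d) ^ 2) ∂ω := by
          refine setLIntegral_mono' (measurableSet_cantorI k d).compl fun x hx => ?_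
          rw [← ENNReal.ofReal_mul (by positivity), mul_one_div]
          have hpos : 0 < Metric.infDist x (cantorI k d) :=
            (isClosed_Icc.notMem_iff_infDist_pos (cantorI_nonempty k d)).1 hx
          have hle := Metric.infDist_le_infDist_of_subset (x := x) hsub
            (nonempty_Icc.2 (sub_pos.1 hL).le)
          gcongr
          linarith
      _ ≤ ENNReal.ofReal ((1 / 3) ^ k) * ENNReal.ofReal (3 * (9 / 2) ^ k) := by
          rw [lintegral_const_mul' _ _ ENNReal.ofReal_ne_top]
          gcongr
          exact h.lintegral_compl_le k d
      _ = ENNReal.ofReal (3 * (3 / 2) ^ k) := by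
          rw [← ENNReal.ofReal_mul (by positivity), mul_left_comm, ← mul_pow]
          norm_num
  rw [poisson, ← lintegral_add_compl _ (measurableSet_cantorI k d)]
  refine (add_le_add hin hout).trans_eq ?_
  rw [← ENNReal.ofReal_add (by positivity) (by positivity)]
  ring_nf

theorem IsCantorMeasure.le_poisson {ω : Measure ℝ} (h : IsCantorMeasure ω) {k : ℕ}
    {d : Fin k → Bool} {a b : ℝ} (hab : a < b)
    (hsub : cantorI k d ⊆ Icc (a - (b - a)) (b + (b - a))) (hup : b - a ≤ (1 / 3) ^ k) :
    ENNReal.ofReal (1 / 4 * (3 / 2) ^ k) ≤ poisson ω a b := by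
  have hL : 0 < b - a := sub_pos.2 hab
  calc ENNReal.ofReal (1 / 4 * (3 / 2) ^ k)
      = ∫⁻ _ in cantorI k d, ENNReal.ofReal (1 / 4 * 3 ^ k) ∂ω := by
        rw [setLIntegral_const, h.measure_cantorI, ← ENNReal.ofReal_mul (by positivity),
          mul_assoc, ← mul_pow]
        norm_num
    _ ≤ ∫⁻ x in cantorI k d,
        ENNReal.ofReal ((b - a) / ((b - a) + Metric.infDist x (Icc a b)) ^ 2) ∂ω := by
        refine setLIntegral_mono' (measurableSet_cantorI k d) fun x hx =>
          ENNReal.ofReal_le_ofReal ?_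
        have hx' := hsub hx
        have hD : Metric.infDist x (Icc a b) ≤ b - a := by
          rcases le_total x b with hxb | hxb
          · refine (Metric.infDist_le_dist_of_mem (left_mem_Icc.2 hab.le)).trans ?_
            rw [Real.dist_eq, abs_le]
            constructor <;> linarith [hx'.1]
          · refine (Metric.infDist_le_dist_of_mem (right_mem_Icc.2 hab.le)).trans ?_
            rw [Real.dist_eq, abs_le]
            constructor <;> linarith [hx'.2]
        have hD0 : 0 ≤ Metric.infDist x (Icc a b) := Metric.infDist_nonneg
        calc (1 / 4 * 3 ^ k : ℝ) = 1 / 4 * (1 / (1 / 3) ^ k) := by simp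
          _ ≤ 1 / 4 * (1 / (b - a)) := by gcongr
          _ = (b - a) / ((b - a) + (b - a)) ^ 2 := by field_simp; norm_num
          _ ≤ _ := by gcongr
    _ ≤ poisson ω a b := setLIntegral_le_lintegral _ _

/-- **Poisson integrals of the Cantor measure.** There are absolute constants `0 < c ≤ C`
such that for every generation `k ≥ 0` and every generation-`k` triadic interval `I_d^k`
with removed middle third `G_d^k`, `c·(3/2)^k ≤ P(I_d^k, ω) ≤ C·(3/2)^k` and
`c·(3/2)^k ≤ P(G_d^k, ω) ≤ C·(3/2)^k`. -/
theorem cantor_poisson_estimates :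
    ∃ c C : ℝ, 0 < c ∧ c ≤ C ∧
      ∀ ω : Measure ℝ, IsCantorMeasure ω →
      ∀ (k : ℕ) (d : Fin k → Bool),
        (ENNReal.ofReal (c * (3/2) ^ k)
            ≤ poisson ω (cantorLeft k d) (cantorLeft k d + (1/3) ^ k) ∧
          poisson ω (cantorLeft k d) (cantorLeft k d + (1/3) ^ k)
            ≤ ENNReal.ofReal (C * (3/2) ^ k)) ∧
        (ENNReal.ofReal (c * (3/2) ^ k) ≤ poisson ω (gLeft k d) (gRight k d) ∧
          poisson ω (gLeft k d) (gRight k d) ≤ ENNReal.ofReal (C * (3/2) ^ k)) := by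
  refine ⟨1 / 4, 6, by norm_num, by norm_num, fun ω h k d => ?_⟩
  have hp : (0 : ℝ) < (1 / 3) ^ k := by positivity
  have hs : (1 / 3 : ℝ) ^ (k + 1) = (1 / 3) ^ k * (1 / 3) := pow_succ _ _
  refine ⟨⟨h.le_poisson (d := d) ?_ ?_ ?_, h.poisson_le (d := d) ?_ ?_ ?_⟩,
    h.le_poisson (d := d) ?_ ?_ ?_, h.poisson_le (d := d) ?_ ?_ ?_⟩ <;>
  (try simp only [cantorI, gLeft, gRight, hs]) <;>
  first
  | linarith
  | (refine Icc_subset_Icc ?_ ?_ <;> linarith)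
end

section
/- Let ω be the Cantor measure on [0,1] with Cantor set E = ⋂_{k≥0} ⋃_{j=1}^{2^k} I_j^k, fix 0 < δ < 1/2, choose for each k ≥ 0 and 1 ≤ j ≤ 2^k a point z_j^k ∈ G_j^k whose distance to each endpoint of G_j^k is at least δ·|G_j^k|, and let σ = Σ_{k≥0} Σ_{j=1}^{2^k} (2/9)^k δ_{z_j^k}. Then for every x ∈ E the series Hσ(x) := Σ_{k≥0} Σ_{j=1}^{2^k} (2/9)^k · (x − z_j^k)^{-1} converges absolutely, and there is a constant C (depending only on δ) such that ∫_{[0,1]} |Hσ(x)|² dω(x) ≤ C. -/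
open MeasureTheory Set ENNReal

/-- The points `z_d^k ∈ G_d^k` lie at distance at least `δ·|G_d^k|` from both endpoints of
`G_d^k` (recall `|G_d^k| = 3^{-(k+1)}`). -/
def GoodPoints (δ : ℝ) (z : (k : ℕ) → (Fin k → Bool) → ℝ) : Prop :=
  ∀ (k : ℕ) (d : Fin k → Bool),
    gLeft k d + δ * (1/3) ^ (k + 1) ≤ z k d ∧ z k d ≤ gRight k d - δ * (1/3) ^ (k + 1)

/-- The measure `σ = Σ_{k,d} (2/9)^k δ_{z_d^k}`. -/
noncomputable def cantorSigma (z : (k : ℕ) → (Fin k → Bool) → ℝ) : Measure ℝ :=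
  Measure.sum fun p : Σ k : ℕ, Fin k → Bool =>
    ((2:ℝ≥0∞)/9) ^ p.1 • Measure.dirac (z p.1 p.2)

/-- The middle-thirds Cantor set `E = ⋂_k ⋃_d I_d^k`. -/
noncomputable def cantorMiddleThirdsSet : Set ℝ :=
  ⋂ k : ℕ, ⋃ d : Fin k → Bool, cantorI k d

lemma cantorLeft_cons (k : ℕ) (b : Bool) (d : Fin k → Bool) :
    cantorLeft (k + 1) (Fin.cons b d) = cond b 2 0 / 3 + cantorLeft k d / 3 := by
  simp only [cantorLeft, Fin.sum_univ_succ, Fin.cons_zero, Fin.cons_succ, Fin.val_zero,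
    Fin.val_succ, Finset.sum_div]
  congr 1
  · simp
  · refine Finset.sum_congr rfl fun i _ => ?_
    rw [div_div, ← pow_succ]

lemma cantorLeft_succ (k : ℕ) (d : Fin (k + 1) → Bool) :
    cantorLeft (k + 1) d =
      cantorLeft k (Fin.init d) + cond (d (Fin.last k)) 2 0 * (1 / 3) ^ (k + 1) := by
  simp only [cantorLeft, Fin.sum_univ_castSucc, Fin.init, Fin.val_castSucc, Fin.val_last]
  rw [one_div, inv_pow, div_eq_mul_inv _ ((3 : ℝ) ^ (k + 1))]

lemma cantorLeft_mem_Icc (k : ℕ) (d : Fin k → Bool) :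
    cantorLeft k d ∈ Icc (0 : ℝ) (1 - (1 / 3) ^ k) := by
  induction k with
  | zero => simp [cantorLeft]
  | succ k ih =>
    rw [← Fin.cons_self_tail d, cantorLeft_cons, pow_succ]
    obtain ⟨h0, h1⟩ := ih (Fin.tail d)
    cases d 0 <;> simp only [cond_true, cond_false] <;> constructor <;> linarith

lemma two_mul_pow_le_abs_cantorLeft_sub {k : ℕ} {d e : Fin k → Bool} (hde : d ≠ e) :
    2 * (1 / 3 : ℝ) ^ k ≤ |cantorLeft k d - cantorLeft k e| := by
  induction k with
  | zero => exact absurd (Subsingleton.elim d e) hde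
  | succ k ih =>
    rw [← Fin.cons_self_tail d, ← Fin.cons_self_tail e] at hde ⊢
    simp only [cantorLeft_cons, pow_succ]
    obtain ⟨hd0, hd1⟩ := cantorLeft_mem_Icc k (Fin.tail d)
    obtain ⟨he0, he1⟩ := cantorLeft_mem_Icc k (Fin.tail e)
    have hp : (0 : ℝ) < (1 / 3) ^ k := by positivity
    have same (h : d 0 = e 0) :
        2 * (1 / 3 : ℝ) ^ k ≤ |cantorLeft k (Fin.tail d) - cantorLeft k (Fin.tail e)| :=
      ih fun h' => hde (by rw [h, h'])
    cases hd : d 0 <;> cases he : e 0 <;> simp only [cond_true, cond_false]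
    · have := same (by rw [hd, he])
      rw [le_abs] at this ⊢
      rcases this with h | h
      · left; linarith
      · right; linarith
    · rw [le_abs]; right; linarith
    · rw [le_abs]; left; linarith
    · have := same (by rw [hd, he])
      rw [le_abs] at this ⊢
      rcases this with h | h
      · left; linarith
      · right; linarith

lemma sum_inv_abs_cantorLeft_sub_le (k : ℕ) (e : Fin k → Bool) :
    ∑ d : Fin k → Bool, (|cantorLeft k d - cantorLeft k e| + (1 / 3) ^ k)⁻¹
      ≤ 4 * 3 ^ k - 3 * 2 ^ k := by
  induction k with
  | zero => simp [cantorLeft]; norm_num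
  | succ k ih =>
    have hp : (0 : ℝ) < (1 / 3) ^ k := by positivity
    have same : ∀ b : Bool, ∀ e : Fin k → Bool,
        ∑ d : Fin k → Bool, (|cantorLeft (k + 1) (Fin.cons b d)
          - cantorLeft (k + 1) (Fin.cons b e)| + (1 / 3) ^ (k + 1))⁻¹
        ≤ 3 * (4 * 3 ^ k - 3 * 2 ^ k) := by
      intro b e
      refine le_trans (le_of_eq ?_) (mul_le_mul_of_nonneg_left (ih e) (by norm_num))
      rw [Finset.mul_sum]
      refine Finset.sum_congr rfl fun d _ => ?_
      rw [cantorLeft_cons, cantorLeft_cons, add_sub_add_left_eq_sub, ← sub_div, abs_div,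
        pow_succ, abs_of_pos (by norm_num : (0 : ℝ) < 3), ← mul_one_div |_|, ← add_mul, mul_inv]
      norm_num [mul_comm]
    have diff : ∀ b : Bool, ∀ e : Fin k → Bool,
        ∑ d : Fin k → Bool, (|cantorLeft (k + 1) (Fin.cons b d)
          - cantorLeft (k + 1) (Fin.cons (!b) e)| + (1 / 3) ^ (k + 1))⁻¹
        ≤ 3 * 2 ^ k := by
      intro b e
      have : ∀ d ∈ (Finset.univ : Finset (Fin k → Bool)), (|cantorLeft (k + 1) (Fin.cons b d)
          - cantorLeft (k + 1) (Fin.cons (!b) e)| + (1 / 3) ^ (k + 1))⁻¹ ≤ 3 := by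
        intro d _
        obtain ⟨hd0, hd1⟩ := cantorLeft_mem_Icc k d
        obtain ⟨he0, he1⟩ := cantorLeft_mem_Icc k e
        have : (1 / 3 : ℝ) ≤ |cantorLeft (k + 1) (Fin.cons b d)
            - cantorLeft (k + 1) (Fin.cons (!b) e)| := by
          rw [cantorLeft_cons, cantorLeft_cons, le_abs]
          cases b <;> simp only [Bool.not_true, Bool.not_false, cond_true, cond_false]
          · right; linarith
          · left; linarith
        refine inv_le_of_inv_le₀ (by norm_num) ?_
        have : (0 : ℝ) < (1 / 3) ^ (k + 1) := by positivity
        linarith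
      refine (Finset.sum_le_card_nsmul _ _ _ this).trans (le_of_eq ?_)
      simp [mul_comm]
    rw [← (Fin.consEquiv fun _ : Fin (k + 1) => Bool).sum_comp, Fintype.sum_prod_type,
      Fintype.sum_bool, ← Fin.cons_self_tail e]
    simp only [Fin.consEquiv, Equiv.coe_fn_mk]
    cases e 0
    · have h1 := same false (Fin.tail e)
      have h2 := diff true (Fin.tail e)
      simp only [Bool.not_true] at h2
      rw [pow_succ (3 : ℝ), pow_succ (2 : ℝ)]
      linarith
    · have h1 := same true (Fin.tail e)
      have h2 := diff false (Fin.tail e)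
      simp only [Bool.not_false] at h2
      rw [pow_succ (3 : ℝ), pow_succ (2 : ℝ)]
      linarith

lemma exists_cantorI_of_mem {x : ℝ} (hx : x ∈ cantorMiddleThirdsSet) (k : ℕ) :
    ∃ e : Fin k → Bool, x ∈ Icc (cantorLeft k e) (gLeft k e) ∪
      Icc (gRight k e) (cantorLeft k e + (1 / 3) ^ k) := by
  obtain ⟨d, hd⟩ := mem_iUnion.1 (mem_iInter.1 hx (k + 1))
  refine ⟨Fin.init d, ?_⟩
  obtain ⟨h0, h1⟩ := hd
  rw [cantorLeft_succ] at h0 h1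
  rw [gLeft, gRight]
  have : (1 / 3 : ℝ) ^ k = 3 * (1 / 3) ^ (k + 1) := by rw [pow_succ]; ring
  cases h : d (Fin.last k) <;> simp only [h, cond_true, cond_false] at h0 h1
  · left; constructor <;> linarith
  · right; constructor <;> linarith

lemma GoodPoints.le_abs_sub {δ : ℝ} (hδ0 : 0 < δ) (hδ1 : δ < 1 / 2)
    {z : (k : ℕ) → (Fin k → Bool) → ℝ} (hz : GoodPoints δ z) {k : ℕ} {e : Fin k → Bool} {x : ℝ}
    (hx : x ∈ Icc (cantorLeft k e) (gLeft k e) ∪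
      Icc (gRight k e) (cantorLeft k e + (1 / 3) ^ k)) (d : Fin k → Bool) :
    δ / 3 * (|cantorLeft k d - cantorLeft k e| + (1 / 3) ^ k) ≤ |x - z k d| := by
  obtain ⟨hz0, hz1⟩ := hz k d
  simp only [gLeft, gRight, pow_succ] at hz0 hz1 hx
  have hp : (0 : ℝ) < (1 / 3) ^ k := by positivity
  have hδp : 0 < δ * (1 / 3) ^ k := by positivity
  rcases eq_or_ne d e with rfl | hde
  · rw [sub_self, abs_zero, zero_add, le_abs]
    rcases hx with ⟨h0, h1⟩ | ⟨h0, h1⟩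
    · right; linarith
    · left; linarith
  · have hsep := two_mul_pow_le_abs_cantorLeft_sub hde
    have hx' : cantorLeft k e ≤ x ∧ x ≤ cantorLeft k e + (1 / 3) ^ k := by
      rcases hx with ⟨h0, h1⟩ | ⟨h0, h1⟩ <;> constructor <;> linarith
    have h1 : δ / 3 * (|cantorLeft k d - cantorLeft k e| + (1 / 3) ^ k)
        ≤ 1 / 3 * (|cantorLeft k d - cantorLeft k e| + (1 / 3) ^ k) := by
      gcongr; linarith
    refine h1.trans ?_
    rcases abs_cases (cantorLeft k d - cantorLeft k e) with ⟨h, _⟩ | ⟨h, _⟩ <;>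
      rw [h] at hsep ⊢ <;> rw [le_abs]
    · right; linarith
    · left; linarith

lemma GoodPoints.sum_inv_abs_sub_le {δ : ℝ} (hδ0 : 0 < δ) (hδ1 : δ < 1 / 2)
    {z : (k : ℕ) → (Fin k → Bool) → ℝ} (hz : GoodPoints δ z) {x : ℝ}
    (hx : x ∈ cantorMiddleThirdsSet) (k : ℕ) :
    ∑ d : Fin k → Bool, |x - z k d|⁻¹ ≤ 12 / δ * 3 ^ k := by
  obtain ⟨e, he⟩ := exists_cantorI_of_mem hx k
  calc ∑ d : Fin k → Bool, |x - z k d|⁻¹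
      ≤ ∑ d : Fin k → Bool, 3 / δ * (|cantorLeft k d - cantorLeft k e| + (1 / 3) ^ k)⁻¹ := by
        refine Finset.sum_le_sum fun d _ => ?_
        rw [← inv_div, ← mul_inv]
        exact inv_anti₀ (by positivity) (hz.le_abs_sub hδ0 hδ1 he d)
    _ ≤ 3 / δ * (4 * 3 ^ k) := by
        rw [← Finset.mul_sum]
        gcongr
        have := sum_inv_abs_cantorLeft_sub_le k e
        have h2 : (0 : ℝ) < 2 ^ k := by positivity
        linarith
    _ = 12 / δ * 3 ^ k := by ring

lemma GoodPoints.summable_and_tsum_le {δ : ℝ} (hδ0 : 0 < δ) (hδ1 : δ < 1 / 2)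
    {z : (k : ℕ) → (Fin k → Bool) → ℝ} (hz : GoodPoints δ z) {x : ℝ}
    (hx : x ∈ cantorMiddleThirdsSet) :
    (Summable fun p : Σ k : ℕ, Fin k → Bool => (2 / 9 : ℝ) ^ p.1 * |x - z p.1 p.2|⁻¹) ∧
      ∑' p : Σ k : ℕ, Fin k → Bool, (2 / 9 : ℝ) ^ p.1 * |x - z p.1 p.2|⁻¹ ≤ 36 / δ := by
  have hgeom : HasSum (fun k : ℕ => 12 / δ * (2 / 3 : ℝ) ^ k) (36 / δ) := by
    have h := (hasSum_geometric_of_lt_one (r := (2 / 3 : ℝ)) (by norm_num)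
      (by norm_num)).mul_left (12 / δ)
    rwa [show 12 / δ * (1 - 2 / 3 : ℝ)⁻¹ = 36 / δ by ring] at h
  have hlevel (k : ℕ) :
      ∑ d : Fin k → Bool, (2 / 9 : ℝ) ^ k * |x - z k d|⁻¹ ≤ 12 / δ * (2 / 3) ^ k := by
    rw [← Finset.mul_sum]
    refine (mul_le_mul_of_nonneg_left (hz.sum_inv_abs_sub_le hδ0 hδ1 hx k)
      (by positivity)).trans (le_of_eq ?_)
    rw [mul_left_comm, ← mul_pow]
    norm_num
  have hsum : Summable fun k : ℕ => ∑ d : Fin k → Bool, (2 / 9 : ℝ) ^ k * |x - z k d|⁻¹ :=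
    Summable.of_nonneg_of_le (fun k => by positivity) hlevel hgeom.summable
  have hs : Summable fun p : Σ k : ℕ, Fin k → Bool =>
      (2 / 9 : ℝ) ^ p.1 * |x - z p.1 p.2|⁻¹ := by
    rw [summable_sigma_of_nonneg fun p => by positivity]
    exact ⟨fun k => Summable.of_finite, by simpa only [tsum_fintype] using hsum⟩
  refine ⟨hs, ?_⟩
  rw [hs.tsum_sigma]
  simp only [tsum_fintype]
  exact (hsum.tsum_le_tsum hlevel hgeom.summable).trans hgeom.tsum_eq.le

lemma pairwise_disjoint_cantorI (k : ℕ) : Pairwise (Function.onFun Disjoint (cantorI k)) := by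
  intro d e hde
  rw [Function.onFun, Set.disjoint_left]
  rintro x ⟨hd0, hd1⟩ ⟨he0, he1⟩
  have hp : (0 : ℝ) < (1 / 3) ^ k := by positivity
  have := two_mul_pow_le_abs_cantorLeft_sub hde
  rw [le_abs] at this
  rcases this with h | h <;> linarith

lemma IsCantorMeasure.ae_mem_cantorMiddleThirdsSet {ω : Measure ℝ} (hω : IsCantorMeasure ω) :
    ∀ᵐ x ∂ω, x ∈ cantorMiddleThirdsSet := by
  obtain ⟨hprob, hI⟩ := hω
  simp only [cantorMiddleThirdsSet, mem_iInter]
  rw [ae_all_iff]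
  intro k
  have hmeas (d : Fin k → Bool) : MeasurableSet (cantorI k d) := measurableSet_Icc
  refine (mem_ae_iff_prob_eq_one (MeasurableSet.iUnion hmeas)).2 ?_
  rw [measure_iUnion (pairwise_disjoint_cantorI k) hmeas, tsum_fintype]
  simp only [hI, Finset.sum_const, Finset.card_univ, Fintype.card_fun, Fintype.card_bool,
    Fintype.card_fin, nsmul_eq_mul, Nat.cast_pow, Nat.cast_ofNat]
  rw [← mul_pow, one_div, ENNReal.mul_inv_cancel (by norm_num) (by norm_num), one_pow]

/-- **Forward testing on the full interval for the Cantor example.** With `ω` the Cantor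
measure, `0 < δ < 1/2`, points `z_d^k ∈ G_d^k` at distance at least `δ|G_d^k|` from the
endpoints of `G_d^k`, and `σ = Σ_{k,d} (2/9)^k δ_{z_d^k}`: for every `x` in the Cantor set
`E` the series `Hσ(x) = Σ_{k,d} (2/9)^k (x - z_d^k)⁻¹` converges absolutely, and there is
`C = C(δ)` with `∫_{[0,1]} |Hσ|² dω ≤ C`. -/
theorem cantor_hilbert_square_integral (δ : ℝ) (hδ0 : 0 < δ) (hδ1 : δ < 1/2) :
    ∃ C : ℝ, 0 < C ∧
      ∀ ω : Measure ℝ, IsCantorMeasure ω →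
      ∀ z : (k : ℕ) → (Fin k → Bool) → ℝ, GoodPoints δ z →
        (∀ x ∈ cantorMiddleThirdsSet,
          Summable fun p : Σ k : ℕ, Fin k → Bool => (2/9 : ℝ) ^ p.1 * |x - z p.1 p.2|⁻¹) ∧
        (∫⁻ x in Set.Icc (0:ℝ) 1,
            ENNReal.ofReal
              ((∑' p : Σ k : ℕ, Fin k → Bool, (2/9 : ℝ) ^ p.1 * (x - z p.1 p.2)⁻¹) ^ 2) ∂ω)
          ≤ ENNReal.ofReal C := by
  refine ⟨(36 / δ) ^ 2, by positivity, fun ω hω z hz =>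
    ⟨fun x hx => (hz.summable_and_tsum_le hδ0 hδ1 hx).1, ?_⟩⟩
  have := hω.1
  calc _ ≤ ∫⁻ _ in Set.Icc (0 : ℝ) 1, ENNReal.ofReal ((36 / δ) ^ 2) ∂ω := by
        refine lintegral_mono_ae (ae_restrict_of_ae ?_)
        filter_upwards [hω.ae_mem_cantorMiddleThirdsSet] with x hx
        obtain ⟨hs, hle⟩ := hz.summable_and_tsum_le hδ0 hδ1 hx
        refine ENNReal.ofReal_le_ofReal (sq_le_sq' ?_ ?_) <;>
        · have h : |∑' p : Σ k : ℕ, Fin k → Bool, (2/9 : ℝ) ^ p.1 * (x - z p.1 p.2)⁻¹|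
              ≤ 36 / δ := by
            rw [← Real.norm_eq_abs]
            refine (tsum_of_norm_bounded hs.hasSum fun p => ?_).trans hle
            rw [norm_mul, norm_inv, Real.norm_eq_abs, Real.norm_eq_abs,
              abs_of_pos (by positivity)]
          linarith [abs_le.1 h]
    _ ≤ ENNReal.ofReal ((36 / δ) ^ 2) := by
        rw [lintegral_const, Measure.restrict_apply_univ]
        exact mul_le_of_le_one_right' prob_le_one
end
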